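/- arXiv:2208.10309 — 2 statements merged into one kernel-verified Lean document; each statement's English description precedes it below -/
import Mathlib

section
/- Let $u$ be a harmonic function on $\mathbb{R}^{n+1}_+$ and let $\nabla u = (\partial_t u, \partial_{x_1} u, \dots, \partial_{x_n} u)$. Then for any exponent $q \ge \frac{n-1}{n}$, the function $|\nabla u|^q$ is subharmonic on $\mathbb{R}^{n+1}_+$, i.e., for every point $\xi \in \mathbb{R}^{n+1}_+$ and every $r>0$ with $\overline{B(\xi,r)} \subset \mathbb{R}^{n+1}_+$, the value $|\nabla u(\xi)|^q$ is at most the average of $|\nabla u|^q$ over the sphere $\partial B(\xi,r)$. -/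
open MeasureTheory Filter Metric
open scoped ENNReal NNReal

/-- A function `v` is subharmonic on `U` if it satisfies the sub-mean-value property on
spheres: for every `ξ ∈ U` and `r > 0` with the closed ball `B(ξ,r)` contained in `U`,
`v(ξ)` is at most the average of `v` over the sphere `∂B(ξ,r)` (computed with respect
to the surface measure on the unit sphere). -/
def SubMeanSphere {m : ℕ} (v : EuclideanSpace ℝ (Fin m) → ℝ)
    (U : Set (EuclideanSpace ℝ (Fin m))) : Prop :=
  ∀ ξ ∈ U, ∀ r : ℝ, 0 < r → Metric.closedBall ξ r ⊆ U →
    v ξ ≤ ⨍ s : Metric.sphere (0 : EuclideanSpace ℝ (Fin m)) 1,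
      v (ξ + r • (s : EuclideanSpace ℝ (Fin m)))
        ∂((volume : Measure (EuclideanSpace ℝ (Fin m))).toSphere)

/-- The partial derivative in the `i`-th coordinate direction. -/
noncomputable def partialDeriv {m : ℕ} (i : Fin m) (f : EuclideanSpace ℝ (Fin m) → ℝ)
    (z : EuclideanSpace ℝ (Fin m)) : ℝ :=
  fderiv ℝ f z (EuclideanSpace.single i 1)

theorem sum_smul_apply_single {m : ℕ} (L : EuclideanSpace ℝ (Fin m) →L[ℝ] ℝ)
    (x : EuclideanSpace ℝ (Fin m)) :
    L x = ∑ i, x i * L (EuclideanSpace.single i 1) := by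
  conv_lhs => rw [← (EuclideanSpace.basisFun (Fin m) ℝ).sum_repr x]
  simp [map_sum]

theorem norm_sq_eq_sum_apply_single {m : ℕ} (L : EuclideanSpace ℝ (Fin m) →L[ℝ] ℝ) :
    ‖L‖ ^ 2 = ∑ i, L (EuclideanSpace.single i 1) ^ 2 := by
  rw [← (InnerProductSpace.toDual ℝ (EuclideanSpace ℝ (Fin m))).symm.norm_map L,
    EuclideanSpace.norm_sq_eq]
  refine Finset.sum_congr rfl fun i _ => ?_
  have : L (EuclideanSpace.single i 1) =
      ((InnerProductSpace.toDual ℝ (EuclideanSpace ℝ (Fin m))).symm L) i := by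
    rw [← InnerProductSpace.toDual_symm_apply (x := EuclideanSpace.single i 1) (y := L)]
    rw [EuclideanSpace.inner_single_right]
    simp
  rw [this, Real.norm_eq_abs, sq_abs]

/-- The refined Kato-type estimate for symmetric trace-free matrices. -/
theorem sum_sq_mulVec_le_of_trace_eq_zero {n : ℕ} (H : Fin (n + 1) → Fin (n + 1) → ℝ)
    (hsymm : ∀ i j, H i j = H j i) (htr : ∑ i, H i i = 0) (a : Fin (n + 1) → ℝ) :
    (n + 1) * ∑ i, (∑ j, H i j * a j) ^ 2 ≤ n * ((∑ i, ∑ j, H i j ^ 2) * ∑ j, a j ^ 2) := by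
  rcases Nat.eq_zero_or_pos n with rfl | hn
  · simp at htr
    simp [htr]
  have hn' : (1 : ℝ) ≤ n := by exact_mod_cast hn
  set b : Fin (n + 1) → ℝ := fun i => ∑ j, H i j * a j with hb
  set s : ℝ := ∑ i, a i * b i with hs
  set A : ℝ := ∑ i, a i ^ 2 with hA
  set B : ℝ := ∑ i, b i ^ 2 with hB
  set Q : ℝ := ∑ i, ∑ j, H i j ^ 2 with hQ
  have hB0 : 0 ≤ B := Finset.sum_nonneg fun i _ => sq_nonneg _
  have hA0 : 0 ≤ A := Finset.sum_nonneg fun i _ => sq_nonneg _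
  have hQ0 : 0 ≤ Q := Finset.sum_nonneg fun i _ => Finset.sum_nonneg fun j _ => sq_nonneg _
  change (n + 1) * B ≤ n * (Q * A)
  set T : Fin (n + 1) → Fin (n + 1) → ℝ := fun i j =>
    (b i * a j + a i * b j) / 2 - if i = j then s / (n + 1) else 0 with hT
  have hHT : ∑ i, ∑ j, H i j * T i j = B := by
    have h1 : ∑ i, ∑ j, H i j * (b i * a j) = B := by
      refine Finset.sum_congr rfl fun i _ => ?_
      rw [sq]
      conv_rhs => rw [show b i * b i = b i * ∑ j, H i j * a j from rfl, Finset.mul_sum]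
      exact Finset.sum_congr rfl fun j _ => by ring
    have h2 : ∑ i, ∑ j, H i j * (a i * b j) = B := by
      rw [Finset.sum_comm, ← h1]
      refine Finset.sum_congr rfl fun i _ => Finset.sum_congr rfl fun j _ => ?_
      rw [hsymm j i]; ring
    have h3 : ∑ i, ∑ j, H i j * (if i = j then s / ((n : ℝ) + 1) else 0) = 0 := by
      simp [← Finset.sum_mul, htr]
    have : ∀ i j, H i j * T i j = (H i j * (b i * a j)) / 2 + (H i j * (a i * b j)) / 2
        - H i j * (if i = j then s / ((n : ℝ) + 1) else 0) := fun i j => by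
      simp only [hT]; ring
    simp only [this, Finset.sum_sub_distrib, Finset.sum_add_distrib, ← Finset.sum_div, h1, h2, h3]
    ring
  have hTT : ∑ i, ∑ j, T i j ^ 2 = (A * B + s ^ 2) / 2 - s ^ 2 / (n + 1) := by
    have h1 : ∑ i, ∑ j, (b i ^ 2 * a j ^ 2) = A * B := by
      simp only [← Finset.mul_sum, ← Finset.sum_mul]; ring
    have h2 : ∑ i, ∑ j, (a i ^ 2 * b j ^ 2) = A * B := by
      simp only [← Finset.mul_sum, ← Finset.sum_mul]; ring
    have h3 : ∑ i, ∑ j, ((a i * b i) * (a j * b j)) = s ^ 2 := by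
      simp only [← Finset.mul_sum, ← Finset.sum_mul]; ring
    have h4 : ∑ i, ∑ j, (if i = j then a i * b j else 0) = s := by
      simp [hs]
    have h5 : ∑ i : Fin (n + 1), ∑ j : Fin (n + 1), (if i = j then (1 : ℝ) else 0) = n + 1 := by
      simp
    have : ∀ i j, T i j ^ 2 = (b i ^ 2 * a j ^ 2) / 4 + (a i ^ 2 * b j ^ 2) / 4
        + ((a i * b i) * (a j * b j)) / 2 - 2 * (s / (n + 1)) * (if i = j then a i * b j else 0)
        + (s / (n + 1)) ^ 2 * (if i = j then 1 else 0) := fun i j => by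
      simp only [hT]
      split_ifs with h
      · subst h; ring
      · ring
    simp only [this, Finset.sum_sub_distrib, Finset.sum_add_distrib, ← Finset.sum_div,
      ← Finset.mul_sum] at h1 h2 h3 h4 h5 ⊢
    simp only [h1, h2, h3, h4, h5]
    field_simp
    ring
  have hcs : B ^ 2 ≤ Q * ((A * B + s ^ 2) / 2 - s ^ 2 / (n + 1)) := by
    rw [← hTT, ← hHT, hQ]
    simp only [← Fintype.sum_prod_type']
    exact Finset.sum_mul_sq_le_sq_mul_sq _ _ _
  have hsle : s ^ 2 ≤ A * B := Finset.sum_mul_sq_le_sq_mul_sq _ _ _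
  have hle : (A * B + s ^ 2) / 2 - s ^ 2 / (n + 1) ≤ n / (n + 1) * (A * B) := by
    have : 0 ≤ (n - 1) / (2 * ((n : ℝ) + 1)) * (A * B - s ^ 2) :=
      mul_nonneg (div_nonneg (by linarith) (by linarith)) (by linarith)
    have e : n / (n + 1) * (A * B) - ((A * B + s ^ 2) / 2 - s ^ 2 / (n + 1)) =
      (n - 1) / (2 * ((n : ℝ) + 1)) * (A * B - s ^ 2) := by field_simp; ring
    linarith
  rcases hB0.eq_or_lt with h0 | h0
  · rw [← h0]; simp; positivity
  have h6 : B * B ≤ (Q * (n / (n + 1) * A)) * B := by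
    calc B * B = B ^ 2 := by ring
      _ ≤ _ := hcs
      _ ≤ Q * (n / (n + 1) * (A * B)) := mul_le_mul_of_nonneg_left hle hQ0
      _ = _ := by ring
  have h7 := le_of_mul_le_mul_right h6 h0
  calc (n + 1) * B ≤ (n + 1) * (Q * (n / (n + 1) * A)) := by gcongr
    _ = _ := by field_simp

section PartialDeriv

variable {m : ℕ} {f g : EuclideanSpace ℝ (Fin m) → ℝ}

theorem ContDiff.partialDeriv {k l : ℕ∞} (hf : ContDiff ℝ l f) (h : k + 1 ≤ l) (i : Fin m) :
    ContDiff ℝ k (partialDeriv i f) :=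
  (hf.fderiv_right (by exact_mod_cast h)).clm_apply contDiff_const

theorem partialDeriv_comm (hf : ContDiff ℝ 2 f) (i j : Fin m) (z : EuclideanSpace ℝ (Fin m)) :
    partialDeriv i (partialDeriv j f) z = partialDeriv j (partialDeriv i f) z := by
  have hd : DifferentiableAt ℝ (fderiv ℝ f) z :=
    (hf.fderiv_right (m := 1) (by norm_num)).differentiable (by norm_num) z
  have key : ∀ a b : Fin m, partialDeriv a (partialDeriv b f) z =
      fderiv ℝ (fderiv ℝ f) z (EuclideanSpace.single a 1) (EuclideanSpace.single b 1) := by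
    intro a b
    unfold partialDeriv
    rw [fderiv_clm_apply hd (differentiableAt_const _)]
    simp
  rw [key, key]
  exact (hf.contDiffAt.isSymmSndFDerivAt (by simp)) _ _

theorem partialDeriv_mul (hf : Differentiable ℝ f) (hg : Differentiable ℝ g) (i : Fin m) :
    partialDeriv i (fun z => f z * g z) = fun z => f z * partialDeriv i g z
      + partialDeriv i f z * g z := by
  ext z
  unfold partialDeriv
  rw [fderiv_fun_mul (hf z) (hg z)]
  simp [mul_comm]

theorem partialDeriv_const_mul (hf : Differentiable ℝ f) (c : ℝ) (i : Fin m) :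
    partialDeriv i (fun z => c * f z) = fun z => c * partialDeriv i f z := by
  ext z
  unfold partialDeriv
  rw [fderiv_const_mul (hf z)]
  simp

theorem partialDeriv_sum {ι : Type*} {s : Finset ι} {F : ι → EuclideanSpace ℝ (Fin m) → ℝ}
    (hF : ∀ k, Differentiable ℝ (F k)) (i : Fin m) :
    partialDeriv i (fun z => ∑ k ∈ s, F k z) = fun z => ∑ k ∈ s, partialDeriv i (F k) z := by
  ext z
  unfold partialDeriv
  rw [fderiv_fun_sum fun k _ => hF k z]
  simp

theorem partialDeriv_rpow (hg : Differentiable ℝ g) (hpos : ∀ z, 0 < g z) (p : ℝ) (i : Fin m) :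
    partialDeriv i (fun z => g z ^ p) = fun z => p * (g z ^ (p - 1) * partialDeriv i g z) := by
  ext z
  unfold partialDeriv
  rw [((hg z).hasFDerivAt.rpow_const (Or.inl (hpos z).ne')).fderiv]
  simp [mul_assoc]

theorem Differentiable.rpow_const_of_pos (hg : Differentiable ℝ g) (hpos : ∀ z, 0 < g z) (p : ℝ) :
    Differentiable ℝ (fun z => g z ^ p) :=
  fun z => (hg z).rpow_const (Or.inl (hpos z).ne')

theorem partialDeriv_partialDeriv_rpow (hg : ContDiff ℝ 2 g) (hpos : ∀ z, 0 < g z) (p : ℝ)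
    (i : Fin m) (z : EuclideanSpace ℝ (Fin m)) :
    partialDeriv i (partialDeriv i (fun z => g z ^ p)) z =
      p * (g z ^ (p - 2) * (g z * partialDeriv i (partialDeriv i g) z
        + (p - 1) * partialDeriv i g z ^ 2)) := by
  have hd : Differentiable ℝ g := hg.differentiable (by norm_num)
  have hd' : Differentiable ℝ (partialDeriv i g) :=
    (ContDiff.partialDeriv (k := 1) (l := 2) hg (by norm_num) i).differentiable (by norm_num)
  have hr := hd.rpow_const_of_pos hpos (p - 1)
  rw [partialDeriv_rpow hd hpos, partialDeriv_const_mul (hr.fun_mul hd'), partialDeriv_mul hr hd',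
    partialDeriv_rpow hd hpos]
  have h1 : g z ^ (p - 1) = g z ^ (p - 2) * g z := by
    rw [← Real.rpow_add_one (hpos z).ne']; ring_nf
  have h2 : p - 1 - 1 = p - 2 := by ring
  simp only [h2, h1]
  ring

/-- The Laplacian of `|∇f|² + ε` for a function `f` that is harmonic near `z`. -/
theorem sum_partialDeriv_partialDeriv_sq_grad (hf : ContDiff ℝ 3 f)
    {V : Set (EuclideanSpace ℝ (Fin m))} (hV : IsOpen V)
    (hharm : ∀ z ∈ V, ∑ i, partialDeriv i (partialDeriv i f) z = 0) (ε : ℝ)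
    {z : EuclideanSpace ℝ (Fin m)} (hz : z ∈ V) :
    ∑ i, partialDeriv i (partialDeriv i (fun z => ∑ k, partialDeriv k f z ^ 2 + ε)) z =
      2 * ∑ i, ∑ k, partialDeriv i (partialDeriv k f) z ^ 2 ∧
    ∀ i, partialDeriv i (fun z => ∑ k, partialDeriv k f z ^ 2 + ε) z =
      2 * ∑ k, partialDeriv i (partialDeriv k f) z * partialDeriv k f z := by
  have hf2 : ContDiff ℝ 2 f := hf.of_le (by norm_num)
  have c1 : ∀ k, ContDiff ℝ 2 (partialDeriv k f) := fun k =>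
    ContDiff.partialDeriv (k := 2) (l := 3) hf (by norm_num) k
  have c2 : ∀ i k, ContDiff ℝ 1 (partialDeriv i (partialDeriv k f)) := fun i k =>
    ContDiff.partialDeriv (k := 1) (l := 2) (c1 k) (by norm_num) i
  have d1 : ∀ k, Differentiable ℝ (partialDeriv k f) := fun k => (c1 k).differentiable (by norm_num)
  have d2 : ∀ i k, Differentiable ℝ (partialDeriv i (partialDeriv k f)) := fun i k =>
    (c2 i k).differentiable (by norm_num)
  have hg1 : ∀ i, partialDeriv i (fun z => ∑ k, partialDeriv k f z ^ 2 + ε) =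
      fun z => 2 * ∑ k, partialDeriv i (partialDeriv k f) z * partialDeriv k f z := by
    intro i
    have e : partialDeriv i (fun z => ∑ k, partialDeriv k f z ^ 2 + ε) =
        partialDeriv i (fun z => ∑ k, partialDeriv k f z * partialDeriv k f z) := by
      ext z
      simp only [sq]
      unfold partialDeriv
      rw [fderiv_add_const]
    rw [e, partialDeriv_sum (fun k => (d1 k).fun_mul (d1 k))]
    ext z
    rw [Finset.mul_sum]
    refine Finset.sum_congr rfl fun k _ => ?_
    rw [partialDeriv_mul (d1 k) (d1 k)]
    ring
  refine ⟨?_, fun i => by rw [hg1]⟩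
  have hthird : ∀ k, ∑ i, partialDeriv i (partialDeriv i (partialDeriv k f)) z = 0 := by
    intro k
    have e1 : ∀ i, partialDeriv i (partialDeriv i (partialDeriv k f)) z =
        partialDeriv k (partialDeriv i (partialDeriv i f)) z := by
      intro i
      have : partialDeriv i (partialDeriv k f) = partialDeriv k (partialDeriv i f) :=
        funext fun y => partialDeriv_comm hf2 i k y
      rw [this, partialDeriv_comm (c1 i)]
    have e2 : ∑ i, partialDeriv k (partialDeriv i (partialDeriv i f)) z =
        partialDeriv k (fun y => ∑ i, partialDeriv i (partialDeriv i f) y) z := by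
      rw [partialDeriv_sum (fun i => d2 i i)]
    rw [Finset.sum_congr rfl fun i _ => e1 i, e2]
    unfold partialDeriv at hharm ⊢
    rw [Filter.EventuallyEq.fderiv_eq (f := fun _ => (0 : ℝ))]
    · simp
    · filter_upwards [hV.mem_nhds hz] with y hy using hharm y hy
  have hg2 : ∀ i, partialDeriv i (partialDeriv i (fun z => ∑ k, partialDeriv k f z ^ 2 + ε)) z =
      2 * ∑ k, partialDeriv i (partialDeriv k f) z ^ 2 +
      2 * ∑ k, partialDeriv i (partialDeriv i (partialDeriv k f)) z * partialDeriv k f z := by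
    intro i
    rw [hg1, partialDeriv_const_mul (f := fun z => ∑ k, partialDeriv i (partialDeriv k f) z *
        partialDeriv k f z) (Differentiable.fun_sum fun k _ => (d2 i k).fun_mul (d1 k)),
      partialDeriv_sum (fun k => (d2 i k).fun_mul (d1 k)), ← mul_add, ← Finset.sum_add_distrib]
    refine congrArg (2 * ·) ?_
    refine Finset.sum_congr rfl fun k _ => ?_
    rw [partialDeriv_mul (d2 i k) (d1 k)]
    ring
  rw [Finset.sum_congr rfl fun i _ => hg2 i, Finset.sum_add_distrib, ← Finset.mul_sum,
    ← Finset.mul_sum, Finset.sum_comm (f := fun i k =>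
      partialDeriv i (partialDeriv i (partialDeriv k f)) z * partialDeriv k f z)]
  simp [← Finset.sum_mul, hthird]

end PartialDeriv

theorem sum_partialDeriv_partialDeriv_rpow_nonneg {n : ℕ} {f : EuclideanSpace ℝ (Fin (n + 1)) → ℝ}
    (hf : ContDiff ℝ 3 f) {V : Set (EuclideanSpace ℝ (Fin (n + 1)))} (hV : IsOpen V)
    (hharm : ∀ z ∈ V, ∑ i, partialDeriv i (partialDeriv i f) z = 0) {ε : ℝ} (hε : 0 < ε)
    {q : ℝ} (hq0 : 0 ≤ q) (hq : (n : ℝ) - 1 ≤ n * q)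
    {z : EuclideanSpace ℝ (Fin (n + 1))} (hz : z ∈ V) :
    0 ≤ ∑ i, partialDeriv i (partialDeriv i
      (fun z => (∑ k, partialDeriv k f z ^ 2 + ε) ^ (q / 2))) z := by
  have hf2 : ContDiff ℝ 2 f := hf.of_le (by norm_num)
  have c1 : ∀ k, ContDiff ℝ 2 (partialDeriv k f) := fun k =>
    ContDiff.partialDeriv (k := 2) (l := 3) hf (by norm_num) k
  set g : EuclideanSpace ℝ (Fin (n + 1)) → ℝ := fun z => ∑ k, partialDeriv k f z ^ 2 + ε with hg
  have hA0 : 0 ≤ ∑ k, partialDeriv k f z ^ 2 := Finset.sum_nonneg fun _ _ => sq_nonneg _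
  have hpos : ∀ z, 0 < g z := fun z =>
    add_pos_of_nonneg_of_pos (Finset.sum_nonneg fun _ _ => sq_nonneg _) hε
  have hgc : ContDiff ℝ 2 g := (ContDiff.sum fun k _ => (c1 k).pow 2).add contDiff_const
  rw [Finset.sum_congr rfl fun i _ => partialDeriv_partialDeriv_rpow hgc hpos (q / 2) i z]
  rw [← Finset.mul_sum, ← Finset.mul_sum, Finset.sum_add_distrib, ← Finset.mul_sum,
    ← Finset.mul_sum]
  obtain ⟨h1, h2⟩ := sum_partialDeriv_partialDeriv_sq_grad hf hV hharm ε hz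
  refine mul_nonneg (by linarith) (mul_nonneg (Real.rpow_nonneg (hpos z).le _) ?_)
  rw [h1, Finset.sum_congr rfl fun i _ => congrArg (· ^ 2) (h2 i)]
  have hkato := sum_sq_mulVec_le_of_trace_eq_zero
    (fun i k => partialDeriv i (partialDeriv k f) z) (fun i k => partialDeriv_comm hf2 i k z)
    (hharm z hz) (fun k => partialDeriv k f z)
  simp only [mul_pow, ← Finset.mul_sum]
  have hgz : g z = ∑ k, partialDeriv k f z ^ 2 + ε := rfl
  rw [hgz]
  set A := ∑ k, partialDeriv k f z ^ 2
  set Q := ∑ i, ∑ k, partialDeriv i (partialDeriv k f) z ^ 2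
  set B := ∑ i, (∑ k, partialDeriv i (partialDeriv k f) z * partialDeriv k f z) ^ 2
  have hQ0 : 0 ≤ Q := Finset.sum_nonneg fun _ _ => Finset.sum_nonneg fun _ _ => sq_nonneg _
  have hB0 : 0 ≤ B := Finset.sum_nonneg fun _ _ => sq_nonneg _
  have hn : (0 : ℝ) ≤ n := Nat.cast_nonneg n
  suffices (2 - q) * B ≤ Q * A by nlinarith [mul_nonneg hQ0 hε.le]
  have hQA := mul_nonneg hQ0 hA0
  rcases le_total q 2 with h | h
  · rcases hn.eq_or_lt with h0 | h0
    · rw [← h0] at hkato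
      have : B = 0 := le_antisymm (by linarith) hB0
      rw [this]; linarith
    · have : n * ((2 - q) * B) ≤ n * (Q * A) := by
        refine le_trans ?_ hkato
        rw [← mul_assoc]
        exact mul_le_mul_of_nonneg_right (by linarith) hB0
      exact le_of_mul_le_mul_left this h0
  · exact (mul_nonpos_of_nonpos_of_nonneg (by linarith) hB0).trans hQA

section Radial

variable {m : ℕ} {v : EuclideanSpace ℝ (Fin m) → ℝ} {β : ℝ → ℝ} {R : ℝ}

theorem integral_radial_mul_fderiv_nonneg (hv : ContDiff ℝ 2 v) (hR : 0 ≤ R)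
    (hlap : ∀ z ∈ closedBall 0 R, 0 ≤ ∑ i, partialDeriv i (partialDeriv i v) z)
    (hβ : Continuous β) (hβ0 : ∀ t, 0 ≤ β t) (hβR : ∀ t, R ^ 2 ≤ t → β t = 0) :
    0 ≤ ∫ x, β (‖x‖ ^ 2) * fderiv ℝ v x x := by
  set θ : ℝ → ℝ := fun t => ∫ s in t..R ^ 2, β s with hθ
  have hθd : ∀ t, HasDerivAt θ (-β t) t := fun t =>
    intervalIntegral.integral_hasDerivAt_left (hβ.intervalIntegrable _ _)
      (hβ.stronglyMeasurableAtFilter _ _) hβ.continuousAt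
  have hθ0 : ∀ t, R ^ 2 ≤ t → θ t = 0 := by
    intro t ht
    simp only [hθ]
    rw [intervalIntegral.integral_congr (g := fun _ => 0)]
    · simp
    · intro s hs
      rw [Set.uIcc_of_ge ht] at hs
      exact hβR s hs.1
  have hθpos : ∀ t, t ≤ R ^ 2 → 0 ≤ θ t := fun t ht =>
    intervalIntegral.integral_nonneg ht fun s _ => hβ0 s
  have hθc : Continuous θ := continuous_iff_continuousAt.2 fun t => (hθd t).continuousAt
  have houtside : ∀ x : EuclideanSpace ℝ (Fin m), x ∉ closedBall 0 R → R ^ 2 ≤ ‖x‖ ^ 2 := by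
    intro x hx
    rw [mem_closedBall_zero_iff, not_le] at hx
    exact pow_le_pow_left₀ hR hx.le 2
  set Φ : EuclideanSpace ℝ (Fin m) → ℝ := fun x => θ (‖x‖ ^ 2) with hΦ
  have hΦd : ∀ x, HasFDerivAt Φ ((-β (‖x‖ ^ 2)) • (2 • innerSL ℝ x)) x := fun x =>
    (hθd _).comp_hasFDerivAt x (hasStrictFDerivAt_norm_sq x).hasFDerivAt
  have hΦi : ∀ i x, fderiv ℝ Φ x (EuclideanSpace.single i 1) = -(2 * (β (‖x‖ ^ 2) * x i)) := by
    intro i x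
    rw [(hΦd x).fderiv]
    simp [EuclideanSpace.inner_single_right]
    ring
  have hΦc : Continuous Φ := by fun_prop
  have hv1 : ∀ i, ContDiff ℝ 1 (partialDeriv i v) := fun i =>
    ContDiff.partialDeriv (k := 1) (l := 2) hv (by norm_num) i
  have hv2 : ∀ i, Continuous (partialDeriv i (partialDeriv i v)) := fun i =>
    (ContDiff.partialDeriv (k := 0) (l := 1) (hv1 i) (by norm_num) i).continuous
  have hint : ∀ h : EuclideanSpace ℝ (Fin m) → ℝ, Continuous h →
      (∀ x, x ∉ closedBall 0 R → h x = 0) → Integrable h := fun h hc h0 =>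
    hc.integrable_of_hasCompactSupport (HasCompactSupport.intro (isCompact_closedBall 0 R)
      fun x hx => h0 x hx)
  have i1 : ∀ i, Integrable fun x => Φ x * partialDeriv i (partialDeriv i v) x := fun i =>
    hint _ (hΦc.mul (hv2 i)) fun x hx => by simp [hΦ, hθ0 _ (houtside x hx)]
  have i2 : ∀ i, Integrable fun x => β (‖x‖ ^ 2) * x i * partialDeriv i v x := fun i =>
    hint _ (by have := (hv1 i).continuous; fun_prop) fun x hx => by
      simp [hβR _ (houtside x hx)]
  have key : ∀ i, ∫ x, Φ x * partialDeriv i (partialDeriv i v) x =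
      2 * ∫ x, β (‖x‖ ^ 2) * x i * partialDeriv i v x := by
    intro i
    have e : ∀ x, fderiv ℝ Φ x (EuclideanSpace.single i 1) * partialDeriv i v x =
        -(2 * (β (‖x‖ ^ 2) * x i * partialDeriv i v x)) := fun x => by rw [hΦi]; ring
    have := integral_mul_fderiv_eq_neg_fderiv_mul_of_integrable (μ := volume) (f := Φ)
      (g := partialDeriv i v) (v := EuclideanSpace.single i (1 : ℝ))
      (by simp only [e]; exact ((i2 i).const_mul 2).neg) (i1 i)
      (hint _ (hΦc.mul (hv1 i).continuous) fun x hx => by simp [hΦ, hθ0 _ (houtside x hx)])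
      (fun x _ => (hΦd x).differentiableAt) (fun x _ => (hv1 i).differentiable (by norm_num) x)
    simp only [e, integral_neg, neg_neg, integral_const_mul] at this
    exact this
  have hsum : ∫ x, β (‖x‖ ^ 2) * fderiv ℝ v x x =
      ∑ i, ∫ x, β (‖x‖ ^ 2) * x i * partialDeriv i v x := by
    rw [← integral_finsetSum _ fun i _ => i2 i]
    refine integral_congr_ae (.of_forall fun x => ?_)
    simp only
    rw [sum_smul_apply_single (fderiv ℝ v x) x, Finset.mul_sum]
    exact Finset.sum_congr rfl fun i _ => by unfold partialDeriv; ring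
  have hnn : 0 ≤ ∫ x, Φ x * ∑ i, partialDeriv i (partialDeriv i v) x := by
    refine integral_nonneg fun x => ?_
    by_cases hx : x ∈ closedBall 0 R
    · refine mul_nonneg (hθpos _ ?_) (hlap x hx)
      rw [mem_closedBall_zero_iff] at hx
      exact pow_le_pow_left₀ (norm_nonneg _) hx 2
    · simp [hΦ, hθ0 _ (houtside x hx)]
  simp only [Finset.mul_sum] at hnn
  rw [integral_finsetSum _ fun i _ => i1 i, Finset.sum_congr rfl fun i _ => key i,
    ← Finset.mul_sum, ← hsum] at hnn
  linarith

theorem partialDeriv_comp_smul (f : EuclideanSpace ℝ (Fin m) → ℝ)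
    (c : ℝ) (i : Fin m) :
    partialDeriv i (fun x => f (c • x)) = fun x => c * partialDeriv i f (c • x) := by
  ext x
  unfold partialDeriv
  rw [fderiv_comp_smul]
  simp

theorem integral_radial_mul_sub_nonneg (hv : ContDiff ℝ 2 v) (hR : 0 ≤ R)
    (hlap : ∀ z ∈ closedBall 0 R, 0 ≤ ∑ i, partialDeriv i (partialDeriv i v) z)
    (hβ : Continuous β) (hβ0 : ∀ t, 0 ≤ β t) (hβR : ∀ t, R ^ 2 ≤ t → β t = 0) :
    0 ≤ ∫ x, β (‖x‖ ^ 2) * (v x - v 0) := by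
  have hvd : Differentiable ℝ v := hv.differentiable (by norm_num)
  have hv' : Continuous (fderiv ℝ v) := hv.continuous_fderiv (by norm_num)
  have hv1 : ∀ i, Differentiable ℝ (partialDeriv i v) := fun i =>
    (ContDiff.partialDeriv (k := 1) (l := 2) hv (by norm_num) i).differentiable (by norm_num)
  have hpos : ∀ t ∈ Set.Ioc (0 : ℝ) 1, 0 ≤ ∫ x, β (‖x‖ ^ 2) * fderiv ℝ v (t • x) x := by
    intro t ht
    have h := integral_radial_mul_fderiv_nonneg (v := fun x => v (t • x)) (by fun_prop) hR ?_
      hβ hβ0 hβR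
    · have e : ∀ x, fderiv ℝ (fun x => v (t • x)) x x = t * fderiv ℝ v (t • x) x := by
        intro x
        rw [fderiv_comp_smul]
        simp
      simp only [e, mul_left_comm _ t, integral_const_mul] at h
      exact nonneg_of_mul_nonneg_right h ht.1
    · intro z hz
      have e : ∀ i, partialDeriv i (partialDeriv i fun x => v (t • x)) z =
          t * (t * partialDeriv i (partialDeriv i v) (t • z)) := by
        intro i
        rw [partialDeriv_comp_smul v, partialDeriv_const_mul (f := fun x =>
          partialDeriv i v (t • x)) ((hv1 i).comp (differentiable_id.const_smul t)),
          partialDeriv_comp_smul (partialDeriv i v)]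
      rw [Finset.sum_congr rfl fun i _ => e i, ← Finset.mul_sum, ← Finset.mul_sum]
      refine mul_nonneg ht.1.le (mul_nonneg ht.1.le (hlap _ ?_))
      rw [mem_closedBall_zero_iff] at hz ⊢
      rw [norm_smul, Real.norm_of_nonneg ht.1.le]
      nlinarith [ht.2, norm_nonneg z]
  have hftc : ∀ x, v x - v 0 = ∫ t in Set.Ioc (0 : ℝ) 1, fderiv ℝ v (t • x) x := by
    intro x
    rw [← intervalIntegral.integral_of_le zero_le_one,
      intervalIntegral.integral_eq_sub_of_hasDerivAt (f := fun t : ℝ => v (t • x))]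
    · simp
    · intro t _
      have := (hvd (t • x)).hasFDerivAt.comp_hasDerivAt t ((hasDerivAt_id t).smul_const x)
      simpa [Function.comp_def] using this
    · exact Continuous.intervalIntegrable (by fun_prop) _ _
  have hset : ∀ F : EuclideanSpace ℝ (Fin m) → ℝ,
      ∫ x, β (‖x‖ ^ 2) * F x = ∫ x in closedBall 0 R, β (‖x‖ ^ 2) * F x := by
    intro F
    refine (setIntegral_eq_integral_of_forall_compl_eq_zero fun x hx => ?_).symm
    rw [mem_closedBall_zero_iff, not_le] at hx
    rw [hβR _ (pow_le_pow_left₀ hR hx.le 2), zero_mul]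
  rw [hset]
  simp only [hftc, ← integral_const_mul]
  rw [integral_integral_swap]
  · refine setIntegral_nonneg measurableSet_Ioc fun t ht => ?_
    rw [← hset fun x => fderiv ℝ v (t • x) x]
    exact hpos t ht
  · rw [Measure.prod_restrict]
    refine IntegrableOn.mono_set (t := closedBall 0 R ×ˢ Set.Icc (0 : ℝ) 1) ?_
      (Set.prod_mono_right Set.Ioc_subset_Icc_self)
    refine ContinuousOn.integrableOn_compact
      ((isCompact_closedBall _ _).prod isCompact_Icc) (Continuous.continuousOn ?_)
    unfold Function.uncurry
    fun_prop

end Radial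

theorem integral_eq_integral_Ioi_integral_sphere {m : ℕ} {f : EuclideanSpace ℝ (Fin m) → ℝ}
    [Nontrivial (EuclideanSpace ℝ (Fin m))] (hf : Integrable f) :
    ∫ x, f x = ∫ y in Set.Ioi (0 : ℝ), y ^ (m - 1) *
      ∫ s : sphere (0 : EuclideanSpace ℝ (Fin m)) 1, f (y • (s : EuclideanSpace ℝ (Fin m)))
        ∂((volume : Measure (EuclideanSpace ℝ (Fin m))).toSphere) := by
  set μ : Measure (EuclideanSpace ℝ (Fin m)) := volume
  set F : sphere (0 : EuclideanSpace ℝ (Fin m)) 1 × Set.Ioi (0 : ℝ) → ℝ :=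
    fun p => f ((p.2 : ℝ) • (p.1 : EuclideanSpace ℝ (Fin m))) with hF
  have hmp := μ.measurePreserving_homeomorphUnitSphereProd
  have hemb := (homeomorphUnitSphereProd (EuclideanSpace ℝ (Fin m))).measurableEmbedding
  have hFc : ∀ x : ({0}ᶜ : Set (EuclideanSpace ℝ (Fin m))),
      F (homeomorphUnitSphereProd _ x) = f x := by
    intro x
    have hx : ‖(x : EuclideanSpace ℝ (Fin m))‖ ≠ 0 := norm_ne_zero_iff.2 x.2
    simp [hF, smul_smul, hx]
  have hFint : Integrable F (μ.toSphere.prod (.volumeIoiPow (m - 1))) := by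
    have h := hmp.integrable_comp_emb (g := F) hemb
    simp only [finrank_euclideanSpace, Fintype.card_fin] at h
    rw [← h]
    simp only [Function.comp_def, hFc]
    have h2 := (integrableOn_iff_comap_subtypeVal (μ := μ) (f := f)
      (measurableSet_singleton (0 : EuclideanSpace ℝ (Fin m))).compl).1 hf.integrableOn
    exact h2
  calc ∫ x, f x ∂μ = ∫ x : ({0}ᶜ : Set (EuclideanSpace ℝ (Fin m))), f x ∂(μ.comap (↑)) := by
        rw [integral_subtype_comap (measurableSet_singleton _).compl f,
          restrict_compl_singleton]
    _ = ∫ p, F p ∂μ.toSphere.prod (.volumeIoiPow (m - 1)) := by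
        have h := hmp.integral_comp hemb F
        simp only [hFc, finrank_euclideanSpace, Fintype.card_fin] at h
        exact h
    _ = ∫ y : Set.Ioi (0 : ℝ), ∫ s, F (s, y) ∂μ.toSphere ∂.volumeIoiPow (m - 1) :=
        integral_prod_symm F hFint
    _ = _ := by
        simp only [Measure.volumeIoiPow, ENNReal.ofReal]
        rw [integral_withDensity_eq_integral_smul, integral_subtype_comap measurableSet_Ioi
          fun a : ℝ => Real.toNNReal (a ^ (m - 1)) • ∫ s : sphere (0 : EuclideanSpace ℝ (Fin m)) 1,
            f (a • (s : EuclideanSpace ℝ (Fin m))) ∂μ.toSphere]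
        · refine setIntegral_congr_fun measurableSet_Ioi fun x hx => ?_
          rw [NNReal.smul_def, Real.coe_toNNReal _ (pow_nonneg (le_of_lt hx) _), smul_eq_mul]
        · exact (measurable_subtype_coe.pow_const _).real_toNNReal

theorem integral_sphere_nonneg_of_forall_radial {m : ℕ} {w : EuclideanSpace ℝ (Fin m) → ℝ}
    [Nontrivial (EuclideanSpace ℝ (Fin m))] (hw : Continuous w) {r R : ℝ} (hr : 0 < r) (hrR : r < R)
    (h : ∀ β : ℝ → ℝ, Continuous β → (∀ t, 0 ≤ β t) → (∀ t, R ^ 2 ≤ t → β t = 0) →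
      0 ≤ ∫ x, β (‖x‖ ^ 2) * w x) :
    0 ≤ ∫ s : sphere (0 : EuclideanSpace ℝ (Fin m)) 1, w (r • (s : EuclideanSpace ℝ (Fin m)))
        ∂((volume : Measure (EuclideanSpace ℝ (Fin m))).toSphere) := by
  set σ := (volume : Measure (EuclideanSpace ℝ (Fin m))).toSphere
  set g : ℝ → ℝ := fun y => ∫ s : sphere (0 : EuclideanSpace ℝ (Fin m)) 1,
    w (y • (s : EuclideanSpace ℝ (Fin m))) ∂σ with hg
  have hgc : Continuous g := by
    have := continuous_parametric_integral_of_continuous (μ := σ)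
      (f := fun (y : ℝ) (s : sphere (0 : EuclideanSpace ℝ (Fin m)) 1) =>
        w (y • (s : EuclideanSpace ℝ (Fin m)))) (by unfold Function.uncurry; fun_prop)
      isCompact_univ
    simpa using this
  change 0 ≤ g r
  by_contra! hneg
  obtain ⟨δ₀, hδ₀, hδneg⟩ := Metric.eventually_nhds_iff.1 (hgc.continuousAt.eventually_lt_const hneg)
  obtain ⟨δ, hδ, hδle⟩ : ∃ δ > 0, δ ≤ δ₀ ∧ δ ≤ r ∧ δ ≤ R - r :=
    ⟨min δ₀ (min r (R - r)), by simp [hδ₀, hr, hrR], by simp, by simp, by simp⟩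
  set b : ℝ → ℝ := fun y => max 0 (δ - |y - r|) with hb
  have hb0 : ∀ y, 0 ≤ b y := fun y => le_max_left _ _
  have hbc : Continuous b := by fun_prop
  have hbz : ∀ y, δ ≤ |y - r| → b y = 0 := fun y hy => max_eq_left (by linarith)
  have hβ := h (fun t => b (√t)) (by fun_prop) (fun t => hb0 _) fun t ht => by
    refine hbz _ ?_
    have : R ≤ √t := Real.le_sqrt_of_sq_le ht
    rw [abs_of_nonneg (by linarith)]
    linarith
  simp only [Real.sqrt_sq (norm_nonneg _)] at hβ
  have hint : Integrable fun x : EuclideanSpace ℝ (Fin m) => b ‖x‖ * w x := by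
    refine Continuous.integrable_of_hasCompactSupport (by fun_prop)
      (HasCompactSupport.intro (isCompact_closedBall 0 R) fun x hx => ?_)
    rw [mem_closedBall_zero_iff, not_le] at hx
    rw [hbz _ (by rw [abs_of_nonneg (by linarith)]; linarith), zero_mul]
  rw [integral_eq_integral_Ioi_integral_sphere hint] at hβ
  set k : ℝ → ℝ := fun y => -(y ^ (m - 1) * (b y * g y)) with hk
  have hkz : ∀ y, δ ≤ |y - r| → k y = 0 := fun y hy => by simp [hk, hbz y hy]
  have hkz' : ∀ y, y ≤ 0 → k y = 0 := fun y hy =>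
    hkz y (by rw [abs_sub_comm, abs_of_nonneg (by linarith)]; linarith)
  have e : ∫ y in Set.Ioi (0 : ℝ), y ^ (m - 1) * ∫ s : sphere (0 : EuclideanSpace ℝ (Fin m)) 1,
      b ‖y • (s : EuclideanSpace ℝ (Fin m))‖ * w (y • (s : EuclideanSpace ℝ (Fin m))) ∂σ =
      -∫ y, k y := by
    rw [← setIntegral_eq_integral_of_forall_compl_eq_zero (s := Set.Ioi 0)
      fun y hy => hkz' y (not_lt.1 hy), ← integral_neg]
    refine setIntegral_congr_fun measurableSet_Ioi fun y hy => ?_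
    have hy' : 0 < y := hy
    have : ∀ s : sphere (0 : EuclideanSpace ℝ (Fin m)) 1,
        ‖y • (s : EuclideanSpace ℝ (Fin m))‖ = y := fun s => by
      rw [norm_smul, norm_eq_of_mem_sphere, Real.norm_of_nonneg hy'.le, mul_one]
    simp only [this, integral_const_mul, hk, neg_neg]
    rfl
  rw [e] at hβ
  have hkpos : 0 < ∫ y, k y := by
    refine Continuous.integral_pos_of_hasCompactSupport_nonneg_nonzero (x := r) (by fun_prop)
      (HasCompactSupport.intro (isCompact_closedBall r δ) fun y hy => ?_) (fun y => ?_) ?_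
    · rw [mem_closedBall, Real.dist_eq, not_le] at hy
      exact hkz y hy.le
    · rcases le_or_gt δ |y - r| with hy | hy
      · exact (hkz y hy).ge
      · have hy0 : 0 ≤ y := by linarith [(abs_lt.1 hy).1]
        have hgy : g y < 0 := hδneg (by rw [Real.dist_eq]; linarith)
        simp only [hk, Pi.zero_apply, ← mul_neg]
        exact mul_nonneg (pow_nonneg hy0 _) (mul_nonneg (hb0 y) (by linarith))
    · have : b r = δ := by simp [hb, hδ.le]
      simp only [hk, this, ne_eq, neg_eq_zero, mul_eq_zero, not_or]
      exact ⟨pow_ne_zero _ hr.ne', hδ.ne', hneg.ne⟩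
  linarith

section Mollification

open scoped Convolution ContDiff

variable {m : ℕ} {u : EuclideanSpace ℝ (Fin m) → ℝ}

theorem HasCompactSupport.partialDeriv (hu : HasCompactSupport u) (i : Fin m) :
    HasCompactSupport (partialDeriv i u) :=
  hu.fderiv_apply ℝ (EuclideanSpace.single i 1)

theorem partialDeriv_normed_convolution (φ : ContDiffBump (0 : EuclideanSpace ℝ (Fin m)))
    (hu : ContDiff ℝ 1 u) (hc : HasCompactSupport u) (i : Fin m) :
    partialDeriv i (φ.normed volume ⋆[ContinuousLinearMap.lsmul ℝ ℝ] u) =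
      φ.normed volume ⋆[ContinuousLinearMap.lsmul ℝ ℝ] partialDeriv i u := by
  ext x
  have hφ : LocallyIntegrable (φ.normed (volume : Measure (EuclideanSpace ℝ (Fin m)))) :=
    φ.continuous_normed.locallyIntegrable
  change fderiv ℝ _ x _ = _
  rw [(hc.hasFDerivAt_convolution_right _ hφ hu x).fderiv,
    convolution_precompR_apply _ hφ (hc.fderiv ℝ) (hu.continuous_fderiv one_ne_zero)]
  rfl

theorem laplacian_normed_convolution_eq_zero (φ : ContDiffBump (0 : EuclideanSpace ℝ (Fin m)))
    (hu : ContDiff ℝ 2 u) (hc : HasCompactSupport u) {z : EuclideanSpace ℝ (Fin m)}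
    (hharm : ∀ y ∈ ball z φ.rOut, ∑ i, partialDeriv i (partialDeriv i u) y = 0) :
    ∑ i, partialDeriv i (partialDeriv i
      (φ.normed volume ⋆[ContinuousLinearMap.lsmul ℝ ℝ] u)) z = 0 := by
  have hu1 : ∀ i, ContDiff ℝ 1 (partialDeriv i u) := fun i =>
    ContDiff.partialDeriv (k := 1) (l := 2) hu (by norm_num) i
  have hu2 : ∀ i, Continuous (partialDeriv i (partialDeriv i u)) := fun i =>
    (ContDiff.partialDeriv (k := 0) (l := 1) (hu1 i) (by norm_num) i).continuous
  have e : ∀ i, partialDeriv i (partialDeriv i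
      (φ.normed volume ⋆[ContinuousLinearMap.lsmul ℝ ℝ] u)) z =
      ∫ t, φ.normed volume t • partialDeriv i (partialDeriv i u) (z - t) := by
    intro i
    rw [partialDeriv_normed_convolution φ (hu.of_le (by norm_num)) hc,
      partialDeriv_normed_convolution φ (hu1 i) (hc.partialDeriv i)]
    rfl
  rw [Finset.sum_congr rfl fun i _ => e i, ← integral_finsetSum]
  · rw [← integral_zero (EuclideanSpace ℝ (Fin m)) ℝ]
    refine integral_congr_ae (.of_forall fun t => ?_)
    simp only [← Finset.smul_sum]
    by_cases ht : t ∈ ball 0 φ.rOut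
    · rw [hharm _ (by simpa [mem_ball, dist_eq_norm] using ht), smul_zero]
    · rw [← φ.support_normed_eq (μ := volume), Function.notMem_support] at ht
      rw [ht, zero_smul]
  · intro i _
    exact (φ.continuous_normed.smul ((hu2 i).comp (by fun_prop))).integrable_of_hasCompactSupport
      φ.hasCompactSupport_normed.smul_right

theorem rpow_norm_fderiv_eq (f : EuclideanSpace ℝ (Fin m) → ℝ) (z : EuclideanSpace ℝ (Fin m))
    (q : ℝ) : ‖fderiv ℝ f z‖ ^ q = (∑ i, partialDeriv i f z ^ 2) ^ (q / 2) := by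
  unfold partialDeriv
  rw [← norm_sq_eq_sum_apply_single, ← Real.rpow_natCast, ← Real.rpow_mul (norm_nonneg _)]
  congr 1
  push_cast
  ring

end Mollification

theorem rpow_norm_fderiv_le_average_sphere {n : ℕ} {u : EuclideanSpace ℝ (Fin (n + 1)) → ℝ}
    (hu : ContDiff ℝ 2 u) (hc : HasCompactSupport u) {r R : ℝ} (hr : 0 < r) (hrR : r < R)
    (hharm : ∀ z ∈ ball 0 R, ∑ i, partialDeriv i (partialDeriv i u) z = 0)
    {q : ℝ} (hq0 : 0 ≤ q) (hq : (n : ℝ) - 1 ≤ n * q) :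
    ‖fderiv ℝ u 0‖ ^ q ≤ ⨍ s : sphere (0 : EuclideanSpace ℝ (Fin (n + 1))) 1,
      ‖fderiv ℝ u (r • (s : EuclideanSpace ℝ (Fin (n + 1))))‖ ^ q
        ∂((volume : Measure (EuclideanSpace ℝ (Fin (n + 1)))).toSphere) := by
  set σ := (volume : Measure (EuclideanSpace ℝ (Fin (n + 1)))).toSphere with hσ
  have hu1 : ∀ i, Continuous (partialDeriv i u) := fun i =>
    (ContDiff.partialDeriv (k := 1) (l := 2) hu (by norm_num) i).continuous
  obtain ⟨d, hd, rfl⟩ : ∃ d > 0, R = r + 3 * d := ⟨(R - r) / 3, by linarith, by ring⟩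
  set φ : ℕ → ContDiffBump (0 : EuclideanSpace ℝ (Fin (n + 1))) := fun k =>
    ⟨d / (k + 1) / 2, d / (k + 1), by positivity, half_lt_self (by positivity)⟩ with hφ
  have hφle : ∀ k, (φ k).rOut ≤ d := fun k =>
    div_le_self hd.le (by have : (0 : ℝ) ≤ k := Nat.cast_nonneg k; linarith)
  have hφ0 : Tendsto (fun k => (φ k).rOut) atTop (nhds 0) := by
    have := (tendsto_one_div_add_atTop_nhds_zero_nat (𝕜 := ℝ)).const_mul d
    simpa [hφ, div_eq_mul_inv] using this
  set w : ℕ → EuclideanSpace ℝ (Fin (n + 1)) → ℝ := fun k =>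
    convolution ((φ k).normed volume) u (ContinuousLinearMap.lsmul ℝ ℝ) volume with hw
  have hwc : ∀ k, ContDiff ℝ 3 (w k) := fun k =>
    (φ k).hasCompactSupport_normed.contDiff_convolution_left (n := 3) _ (φ k).contDiff_normed
      hu.continuous.locallyIntegrable
  have hw1 : ∀ k i, ContDiff ℝ 2 (partialDeriv i (w k)) := fun k i =>
    ContDiff.partialDeriv (k := 2) (l := 3) (hwc k) (by norm_num) i
  have hwd : ∀ k i, partialDeriv i (w k) = convolution ((φ k).normed volume) (partialDeriv i u)
      (ContinuousLinearMap.lsmul ℝ ℝ) volume := fun k i =>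
    partialDeriv_normed_convolution (φ k) (hu.of_le (by norm_num)) hc i
  have hwharm : ∀ k, ∀ z ∈ ball 0 (r + 2 * d),
      ∑ i, partialDeriv i (partialDeriv i (w k)) z = 0 := by
    intro k z hz
    refine laplacian_normed_convolution_eq_zero (φ k) hu hc fun y hy => hharm y ?_
    have h1 := mem_ball.1 hz
    have h2 := mem_ball.1 hy
    have h3 := dist_triangle y z 0
    exact mem_ball.2 (by linarith [hφle k])
  have hwlim : ∀ i x, Tendsto (fun k => partialDeriv i (w k) x) atTop
      (nhds (partialDeriv i u x)) := by
    intro i x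
    simp only [hwd]
    exact ContDiffBump.convolution_tendsto_right_of_continuous hφ0 (hu1 i) x
  choose C hC using fun i => (hc.partialDeriv i).exists_bound_of_continuous (hu1 i)
  have hwbound : ∀ k i x, |partialDeriv i (w k) x| ≤ 3 * C i := by
    intro k i x
    have h1 : dist (partialDeriv i (w k) x) (partialDeriv i u x) ≤ 2 * C i := by
      rw [hwd]
      refine (φ k).dist_normed_convolution_le (hu1 i).aestronglyMeasurable fun y _ => ?_
      rw [dist_eq_norm]
      linarith [norm_sub_le (partialDeriv i u y) (partialDeriv i u x), hC i x, hC i y]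
    have h2 := hC i x
    rw [Real.dist_eq] at h1
    rw [Real.norm_eq_abs] at h2
    linarith [abs_sub_abs_le_abs_sub (partialDeriv i (w k) x) (partialDeriv i u x)]
  set ε : ℕ → ℝ := fun k => 1 / ((k : ℝ) + 1) with hε
  have hε0 : ∀ k, 0 < ε k := fun k => Nat.one_div_pos_of_nat
  have hε1 : ∀ k, ε k ≤ 1 := fun k =>
    div_le_self zero_le_one (by have : (0 : ℝ) ≤ k := Nat.cast_nonneg k; linarith)
  set v : ℕ → EuclideanSpace ℝ (Fin (n + 1)) → ℝ := fun k z =>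
    (∑ i, partialDeriv i (w k) z ^ 2 + ε k) ^ (q / 2) with hv
  have hbase : ∀ k z, 0 < ∑ i, partialDeriv i (w k) z ^ 2 + ε k := fun k z =>
    add_pos_of_nonneg_of_pos (Finset.sum_nonneg fun _ _ => sq_nonneg _) (hε0 k)
  have hvc : ∀ k, ContDiff ℝ 2 (v k) := fun k =>
    ((ContDiff.sum fun i _ => (hw1 k i).pow 2).add contDiff_const).rpow_const_of_ne
      fun z => (hbase k z).ne'
  have hmain : ∀ k, 0 ≤ ∫ s : sphere (0 : EuclideanSpace ℝ (Fin (n + 1))) 1,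
      (v k (r • (s : EuclideanSpace ℝ (Fin (n + 1)))) - v k 0) ∂σ := by
    intro k
    refine integral_sphere_nonneg_of_forall_radial (w := fun x => v k x - v k 0)
      ((hvc k).continuous.sub continuous_const) hr (R := r + d) (by linarith) fun β h1 h2 h3 =>
      integral_radial_mul_sub_nonneg (hvc k) (by linarith) (fun z hz => ?_) h1 h2 h3
    exact sum_partialDeriv_partialDeriv_rpow_nonneg (hwc k) isOpen_ball (hwharm k) (hε0 k) hq0 hq
      (closedBall_subset_ball (by linarith) hz)
  set M : ℝ := (∑ i, (3 * C i) ^ 2 + 1) ^ (q / 2)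
  have hvbound : ∀ k x, |v k x| ≤ M := by
    intro k x
    rw [abs_of_nonneg (Real.rpow_nonneg (hbase k x).le _)]
    refine Real.rpow_le_rpow (hbase k x).le (add_le_add (Finset.sum_le_sum fun i _ => ?_) (hε1 k))
      (by linarith)
    exact sq_le_sq.2 ((hwbound k i x).trans (le_abs_self _))
  have hvlim : ∀ x, Tendsto (fun k => v k x) atTop (nhds (‖fderiv ℝ u x‖ ^ q)) := by
    intro x
    rw [rpow_norm_fderiv_eq]
    have h := (tendsto_finsetSum Finset.univ fun i _ => (hwlim i x).pow 2).add
      (tendsto_one_div_add_atTop_nhds_zero_nat (𝕜 := ℝ))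
    rw [add_zero] at h
    exact h.rpow_const (Or.inr (by linarith))
  have hlim := tendsto_integral_of_dominated_convergence (μ := σ)
    (F := fun k (s : sphere (0 : EuclideanSpace ℝ (Fin (n + 1))) 1) =>
      v k (r • (s : EuclideanSpace ℝ (Fin (n + 1)))) - v k 0)
    (f := fun s => ‖fderiv ℝ u (r • (s : EuclideanSpace ℝ (Fin (n + 1))))‖ ^ q -
      ‖fderiv ℝ u 0‖ ^ q) (fun _ => 2 * M)
    (fun k => by
      have := (hvc k).continuous
      exact Continuous.aestronglyMeasurable (by fun_prop))
    (integrable_const _)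
    (fun k => .of_forall fun s => by
      rw [Real.norm_eq_abs]
      linarith [abs_sub (v k (r • (s : EuclideanSpace ℝ (Fin (n + 1))))) (v k 0),
        hvbound k (r • (s : EuclideanSpace ℝ (Fin (n + 1)))), hvbound k 0])
    (.of_forall fun s => (hvlim _).sub (hvlim _))
  have hnn := ge_of_tendsto' hlim hmain
  have hcont : Continuous fun s : sphere (0 : EuclideanSpace ℝ (Fin (n + 1))) 1 =>
      ‖fderiv ℝ u (r • (s : EuclideanSpace ℝ (Fin (n + 1))))‖ ^ q := by
    have := hu.continuous_fderiv (by norm_num)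
    exact Continuous.rpow_const (by fun_prop) fun _ => Or.inr hq0
  rw [integral_sub (hcont.integrable_of_hasCompactSupport (HasCompactSupport.of_compactSpace _))
    (integrable_const _), integral_const, smul_eq_mul] at hnn
  have hσpos : 0 < σ.real Set.univ := by
    rw [hσ, Measure.toSphere_real_apply_univ]
    refine mul_pos (by simp; positivity) ?_
    exact ENNReal.toReal_pos (measure_ball_pos _ _ one_pos).ne' measure_ball_lt_top.ne
  rw [average_eq, smul_eq_mul, le_inv_mul_iff₀ hσpos]
  linarith

theorem partialDeriv_comp_add_left {m : ℕ} (f : EuclideanSpace ℝ (Fin m) → ℝ)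
    (a : EuclideanSpace ℝ (Fin m)) (i : Fin m) :
    partialDeriv i (fun x => f (a + x)) = fun x => partialDeriv i f (a + x) := by
  ext x
  unfold partialDeriv
  rw [fderiv_comp_add_left]

theorem subMeanSphere_rpow_norm_fderiv {n : ℕ} {u : EuclideanSpace ℝ (Fin (n + 1)) → ℝ}
    {U : Set (EuclideanSpace ℝ (Fin (n + 1)))} (hU : IsOpen U) (hu : ContDiffOn ℝ 2 u U)
    (hharm : ∀ z ∈ U, ∑ i, partialDeriv i (partialDeriv i u) z = 0)
    {q : ℝ} (hq0 : 0 ≤ q) (hq : (n : ℝ) - 1 ≤ n * q) :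
    SubMeanSphere (fun z => ‖fderiv ℝ u z‖ ^ q) U := by
  intro ξ _ r hr hball
  obtain ⟨δ, hδ, hδU⟩ := (isCompact_closedBall ξ r).exists_cthickening_subset_open hU hball
  rw [cthickening_closedBall hδ.le hr.le] at hδU
  let χ : ContDiffBump ξ := ⟨r + δ / 2, r + δ, by linarith, by linarith⟩
  set g : EuclideanSpace ℝ (Fin (n + 1)) → ℝ := fun x => χ x * u x with hg
  have hgc : ContDiff ℝ 2 g := by
    refine contDiff_iff_contDiffAt.2 fun x => ?_
    by_cases hx : x ∈ tsupport g
    swap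
    · exact contDiffAt_const.congr_of_eventuallyEq (notMem_tsupport_iff_eventuallyEq.1 hx)
    have hx' : x ∈ U := by
      refine hδU ?_
      have := tsupport_mul_subset_left hx
      rw [χ.tsupport_eq] at this
      rwa [add_comm δ r]
    exact χ.contDiff.contDiffAt.mul (hu.contDiffAt (hU.mem_nhds hx'))
  have hgs : HasCompactSupport g := χ.hasCompactSupport.mul_right
  have hgu : ∀ x ∈ ball ξ (r + δ / 2), g =ᶠ[nhds x] u := by
    intro x hx
    filter_upwards [isOpen_ball.mem_nhds hx] with y hy
    simp [hg, χ.one_of_mem_closedBall (ball_subset_closedBall hy)]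
  have hgfd : ∀ x ∈ ball ξ (r + δ / 2), fderiv ℝ g x = fderiv ℝ u x := fun x hx =>
    (hgu x hx).fderiv_eq
  have hglap : ∀ x ∈ ball ξ (r + δ / 2), ∀ i, partialDeriv i (partialDeriv i g) x =
      partialDeriv i (partialDeriv i u) x := by
    intro x hx i
    have : partialDeriv i g =ᶠ[nhds x] partialDeriv i u := by
      filter_upwards [isOpen_ball.mem_nhds hx] with y hy
      unfold partialDeriv
      rw [hgfd y hy]
    unfold partialDeriv at this ⊢
    rw [this.fderiv_eq]
  have hmain := rpow_norm_fderiv_le_average_sphere (u := fun x => g (ξ + x)) (R := r + δ / 2)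
    (by fun_prop) (hgs.comp_homeomorph (Homeomorph.addLeft ξ)) hr (by linarith) (fun z hz => by
      have hz' : ξ + z ∈ ball ξ (r + δ / 2) := by simpa using hz
      simp only [partialDeriv_comp_add_left]
      rw [Finset.sum_congr rfl fun i _ => hglap _ hz' i]
      refine hharm _ (hδU ?_)
      rw [mem_ball] at hz'
      exact mem_closedBall.2 (by linarith)) hq0 hq
  simp only [fderiv_comp_add_left, add_zero] at hmain
  rw [hgfd ξ (mem_ball_self (by linarith))] at hmain
  have e : ∀ s : sphere (0 : EuclideanSpace ℝ (Fin (n + 1))) 1,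
      fderiv ℝ g (ξ + r • (s : EuclideanSpace ℝ (Fin (n + 1)))) =
      fderiv ℝ u (ξ + r • (s : EuclideanSpace ℝ (Fin (n + 1)))) := fun s => by
    refine hgfd _ ?_
    rw [mem_ball, dist_eq_norm, add_sub_cancel_left, norm_smul, norm_eq_of_mem_sphere,
      Real.norm_of_nonneg hr.le]
    linarith
  simpa only [e] using hmain

/-- **Subharmonicity of powers of the gradient of a harmonic function.** If `u` is
harmonic on the upper half-space `ℝ^{n+1}_+ = {z : 0 < z 0}` (with `z 0` playing the
role of `t`), then for every `q ≥ (n-1)/n`, `|∇u|^q` is subharmonic on `ℝ^{n+1}_+`. -/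
theorem stmt_9 (n : ℕ) (u : EuclideanSpace ℝ (Fin (n + 1)) → ℝ)
    (hu : ContDiffOn ℝ 2 u {z : EuclideanSpace ℝ (Fin (n + 1)) | 0 < z 0})
    (hharm : ∀ z ∈ {z : EuclideanSpace ℝ (Fin (n + 1)) | 0 < z 0},
      ∑ i : Fin (n + 1),
        fderiv ℝ (fun w => fderiv ℝ u w (EuclideanSpace.single i 1)) z
          (EuclideanSpace.single i 1) = 0)
    (q : ℝ) (hq : ((n : ℝ) - 1) / n ≤ q) :
    SubMeanSphere (fun z => ‖fderiv ℝ u z‖ ^ q)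
      {z : EuclideanSpace ℝ (Fin (n + 1)) | 0 < z 0} := by
  have hopen : IsOpen {z : EuclideanSpace ℝ (Fin (n + 1)) | 0 < z 0} :=
    isOpen_lt continuous_const (by fun_prop)
  have hq' : 0 ≤ q ∧ (n : ℝ) - 1 ≤ n * q := by
    rcases Nat.eq_zero_or_pos n with rfl | hn
    · simpa using hq
    · have h1 : (1 : ℝ) ≤ n := by exact_mod_cast hn
      refine ⟨(div_nonneg (by linarith) (by linarith)).trans hq, ?_⟩
      rwa [div_le_iff₀' (by linarith)] at hq
  exact subMeanSphere_rpow_norm_fderiv hopen hu hharm hq'.1 hq'.2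
end

section
/- Let $F = (u_0, u_1, \dots, u_n)$ be a vector of harmonic functions on $\mathbb{R}^{n+1}_+$ satisfying the generalized Cauchy--Riemann equations. Then for any $q \ge \frac{n-1}{n}$, the function $|F|^q = \left(\sum_{j=0}^n |u_j|^2\right)^{q/2}$ is subharmonic on $\mathbb{R}^{n+1}_+$. -/
open MeasureTheory Filter Metric
open scoped ENNReal NNReal

/-- Polar coordinates: a function with nonpositive integral over every sphere centred at the
origin has nonpositive integral. -/
theorem integral_nonpos_of_sphere_integral_nonpos {E : Type*} [NormedAddCommGroup E]
    [NormedSpace ℝ E] [FiniteDimensional ℝ E] [Nontrivial E] [MeasurableSpace E] [BorelSpace E]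
    (μ : Measure E) [μ.IsAddHaarMeasure] (f : E → ℝ)
    (h : ∀ ρ : ℝ, 0 < ρ → ∫ s : sphere (0 : E) 1, f (ρ • (s : E)) ∂μ.toSphere ≤ 0) :
    ∫ x, f x ∂μ ≤ 0 := by
  by_cases hf : Integrable f μ
  swap
  · rw [integral_undef hf]
  have hmp := μ.measurePreserving_homeomorphUnitSphereProd
  have hemb := (homeomorphUnitSphereProd E).measurableEmbedding
  let g : sphere (0 : E) 1 × Set.Ioi (0 : ℝ) → ℝ := fun p => f (p.2.1 • (p.1 : E))
  have hg : (fun x : ({0}ᶜ : Set E) => g (homeomorphUnitSphereProd E x)) = fun x => f x.1 := by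
    funext x
    have hx : ‖(x : E)‖ ≠ 0 := norm_ne_zero_iff.2 x.2
    simp [g, smul_smul, hx]
  have hms : MeasurableSet ({0}ᶜ : Set E) := (measurableSet_singleton _).compl
  have h1 : ∫ x, f x ∂μ
      = ∫ p, g p ∂(μ.toSphere.prod (Measure.volumeIoiPow (Module.finrank ℝ E - 1))) := by
    rw [← hmp.integral_comp hemb, hg, integral_subtype_comap hms, restrict_compl_singleton]
  have hint : Integrable g (μ.toSphere.prod (Measure.volumeIoiPow (Module.finrank ℝ E - 1))) := by
    rw [← hmp.integrable_comp_emb hemb]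
    change Integrable (fun x : ({0}ᶜ : Set E) => g (homeomorphUnitSphereProd E x)) _
    rw [hg]
    exact ((MeasurableEmbedding.subtype_coe hms).integrableOn_range_iff_comap).1 hf.integrableOn
  rw [h1, integral_prod_symm _ hint]
  exact integral_nonpos fun ρ => h ρ.1 ρ.2

/-- Integration by parts of a Laplacian against a radial compactly supported weight. -/
theorem integral_radial_mul_fderiv_eq {m : ℕ} {w : EuclideanSpace ℝ (Fin m) → ℝ}
    (hw : ContDiff ℝ 2 w) {G : ℝ → ℝ} (hG : ContDiff ℝ 1 G) {b : ℝ}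
    (hGb : ∀ s, b ≤ s → G s = 0) (ξ : EuclideanSpace ℝ (Fin m)) (t : ℝ) :
    2 * ∫ x, deriv G (‖x‖ ^ 2) * fderiv ℝ w (ξ + t • x) x
      = -t * ∫ x, G (‖x‖ ^ 2) * ∑ i, fderiv ℝ (fun y => fderiv ℝ w y (EuclideanSpace.single i 1))
          (ξ + t • x) (EuclideanSpace.single i 1) := by
  let e : Fin m → EuclideanSpace ℝ (Fin m) := fun i => EuclideanSpace.single i 1
  let H : EuclideanSpace ℝ (Fin m) → ℝ := fun x => G (‖x‖ ^ 2)
  have hH : ContDiff ℝ 1 H := hG.comp (contDiff_norm_sq ℝ)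
  have hHs : HasCompactSupport H := by
    refine HasCompactSupport.intro (isCompact_closedBall 0 (Real.sqrt |b|)) fun x hx => hGb _ ?_
    rw [mem_closedBall_zero_iff, not_le] at hx
    have := Real.lt_sq_of_sqrt_lt hx
    exact (le_abs_self b).trans this.le
  have hdH : ∀ x i, fderiv ℝ H x (e i) = 2 * (deriv G (‖x‖ ^ 2) * x i) := by
    intro x i
    have h1 := (hG.differentiable one_ne_zero (‖x‖ ^ 2)).hasDerivAt.comp_hasFDerivAt x
      (hasStrictFDerivAt_norm_sq x).hasFDerivAt
    have h2 : fderiv ℝ H x = _ := h1.fderiv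
    rw [h2]
    simp [e, EuclideanSpace.inner_single_right]
    ring
  have hgi : ∀ i, ContDiff ℝ 1 fun y => fderiv ℝ w y (e i) := fun i =>
    (hw.fderiv_right (m := 1) (by norm_num)).clm_apply contDiff_const
  have haff : ContDiff ℝ 1 fun x : EuclideanSpace ℝ (Fin m) => ξ + t • x := by fun_prop
  have hgi' : ∀ i, ContDiff ℝ 1 fun x => fderiv ℝ w (ξ + t • x) (e i) := fun i =>
    (hgi i).comp haff
  have hdg : ∀ i x, fderiv ℝ (fun x => fderiv ℝ w (ξ + t • x) (e i)) x (e i)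
      = t * fderiv ℝ (fun y => fderiv ℝ w y (e i)) (ξ + t • x) (e i) := by
    intro i x
    have h1 := ((hgi i).differentiable one_ne_zero (ξ + t • x)).hasFDerivAt.comp x
      (((hasFDerivAt_id x).const_smul t).const_add ξ)
    have h2 : fderiv ℝ (fun x => fderiv ℝ w (ξ + t • x) (e i)) x = _ := h1.fderiv
    rw [h2]
    simp
  have hcH : Continuous H := hH.continuous
  have hcdH : ∀ i, Continuous fun x => fderiv ℝ H x (e i) := fun i =>
    (hH.continuous_fderiv one_ne_zero).clm_apply continuous_const
  have hcdg : ∀ i, Continuous fun x =>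
      fderiv ℝ (fun x => fderiv ℝ w (ξ + t • x) (e i)) x (e i) := fun i =>
    ((hgi' i).continuous_fderiv one_ne_zero).clm_apply continuous_const
  have I1 : ∀ i, Integrable fun x => fderiv ℝ H x (e i) * fderiv ℝ w (ξ + t • x) (e i) := fun i =>
    ((hcdH i).mul (hgi' i).continuous).integrable_of_hasCompactSupport
      ((hHs.fderiv_apply ℝ (e i)).mul_right)
  have I2 : ∀ i, Integrable fun x =>
      H x * fderiv ℝ (fun x => fderiv ℝ w (ξ + t • x) (e i)) x (e i) := fun i =>
    (hcH.mul (hcdg i)).integrable_of_hasCompactSupport hHs.mul_right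
  have I3 : ∀ i, Integrable fun x => H x * fderiv ℝ w (ξ + t • x) (e i) := fun i =>
    (hcH.mul (hgi' i).continuous).integrable_of_hasCompactSupport hHs.mul_right
  have key : ∀ i, ∫ x, H x * fderiv ℝ (fun x => fderiv ℝ w (ξ + t • x) (e i)) x (e i)
      = -∫ x, fderiv ℝ H x (e i) * fderiv ℝ w (ξ + t • x) (e i) := fun i =>
    integral_mul_fderiv_eq_neg_fderiv_mul_of_integrable (I1 i) (I2 i) (I3 i)
      (fun x _ => hH.differentiable one_ne_zero x)
      (fun x _ => (hgi' i).differentiable one_ne_zero x)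
  have hL : 2 * ∫ x, deriv G (‖x‖ ^ 2) * fderiv ℝ w (ξ + t • x) x
      = ∑ i, ∫ x, fderiv ℝ H x (e i) * fderiv ℝ w (ξ + t • x) (e i) := by
    rw [← integral_finsetSum _ fun i _ => I1 i, ← integral_const_mul]
    congr 1
    funext x
    have hx : x = ∑ i, x i • e i := by
      have := (EuclideanSpace.basisFun (Fin m) ℝ).sum_repr x
      simpa [e] using this.symm
    conv_lhs => rw [show fderiv ℝ w (ξ + t • x) x = ∑ i, x i * fderiv ℝ w (ξ + t • x) (e i) by
      conv_lhs => rw [hx, map_sum]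
      rw [← hx]
      simp]
    rw [Finset.mul_sum, Finset.mul_sum]
    refine Finset.sum_congr rfl fun i _ => ?_
    rw [hdH]
    ring
  have hR : -t * ∫ x, G (‖x‖ ^ 2) * ∑ i, fderiv ℝ (fun y => fderiv ℝ w y (e i)) (ξ + t • x) (e i)
      = -∑ i, ∫ x, H x * fderiv ℝ (fun x => fderiv ℝ w (ξ + t • x) (e i)) x (e i) := by
    rw [← integral_finsetSum _ fun i _ => I2 i, neg_mul, ← integral_const_mul]
    congr 2
    funext x
    rw [Finset.mul_sum, Finset.mul_sum]
    refine Finset.sum_congr rfl fun i _ => ?_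
    rw [hdg]
    simp only [H]
    ring
  rw [hL, hR, ← Finset.sum_neg_distrib]
  exact Finset.sum_congr rfl fun i _ => by rw [key i, neg_neg]

/-- A `C²` function with nonnegative Laplacian on a ball is at its centre at most any radial
weighted average over the ball. -/
theorem mul_integral_radial_le {m : ℕ} {w : EuclideanSpace ℝ (Fin m) → ℝ}
    (hw : ContDiff ℝ 2 w) {ξ : EuclideanSpace ℝ (Fin m)} {r : ℝ} (hr : 0 < r)
    (hlap : ∀ z ∈ ball ξ r, 0 ≤ ∑ i, fderiv ℝ (fun y => fderiv ℝ w y (EuclideanSpace.single i 1))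
          z (EuclideanSpace.single i 1))
    {G : ℝ → ℝ} (hG : ContDiff ℝ 1 G) (hmono : Monotone G)
    (hGb : ∀ s, r ^ 2 ≤ s → G s = 0) :
    w ξ * ∫ x : EuclideanSpace ℝ (Fin m), deriv G (‖x‖ ^ 2)
      ≤ ∫ x, deriv G (‖x‖ ^ 2) * w (ξ + x) := by
  have hG0 : ∀ s, G s ≤ 0 := fun s =>
    (hmono (le_max_left s (r ^ 2))).trans (hGb _ (le_max_right _ _)).le
  have hh : Continuous (deriv G) := hG.continuous_deriv le_rfl
  have hdG : ∀ s, r ^ 2 < s → deriv G s = 0 := fun s hs => by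
    have : G =ᶠ[nhds s] fun _ => 0 := by
      filter_upwards [lt_mem_nhds hs] with u hu using hGb u hu.le
    rw [this.deriv_eq, deriv_const]
  have hout : ∀ x : EuclideanSpace ℝ (Fin m), x ∉ closedBall (0 : EuclideanSpace ℝ (Fin m)) r →
      deriv G (‖x‖ ^ 2) = 0 := fun x hx => by
    rw [mem_closedBall_zero_iff, not_le] at hx
    exact hdG _ (by gcongr)
  have hhx : Continuous fun x : EuclideanSpace ℝ (Fin m) => deriv G (‖x‖ ^ 2) := by fun_prop
  have hhs : HasCompactSupport fun x : EuclideanSpace ℝ (Fin m) => deriv G (‖x‖ ^ 2) :=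
    HasCompactSupport.intro (isCompact_closedBall 0 r) hout
  have hwc := hw.continuous
  have hdw : Continuous (fderiv ℝ w) := hw.continuous_fderiv two_ne_zero
  have hder : ∀ t : ℝ, HasDerivAt (fun t : ℝ => ∫ x, deriv G (‖x‖ ^ 2) * w (ξ + t • x))
      (∫ x, deriv G (‖x‖ ^ 2) * fderiv ℝ w (ξ + t • x) x) t := by
    intro t
    have hF'c : Continuous fun p : ℝ × EuclideanSpace ℝ (Fin m) =>
        deriv G (‖p.2‖ ^ 2) * fderiv ℝ w (ξ + p.1 • p.2) p.2 := by
      refine Continuous.mul (by fun_prop) ?_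
      exact (hdw.comp (by fun_prop)).clm_apply continuous_snd
    obtain ⟨C, hC⟩ := ((isCompact_closedBall t 1).prod
      (isCompact_closedBall (0 : EuclideanSpace ℝ (Fin m)) r)).exists_bound_of_continuousOn
      hF'c.continuousOn
    refine (hasDerivAt_integral_of_dominated_loc_of_deriv_le (s := closedBall t 1)
      (bound := (closedBall (0 : EuclideanSpace ℝ (Fin m)) r).indicator fun _ => C)
      (F' := fun t x => deriv G (‖x‖ ^ 2) * fderiv ℝ w (ξ + t • x) x)
      (closedBall_mem_nhds t one_pos) ?_ ?_ ?_ ?_ ?_ ?_).2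
    · exact .of_forall fun t => Continuous.aestronglyMeasurable (by fun_prop)
    · exact Continuous.integrable_of_hasCompactSupport (by fun_prop) hhs.mul_right
    · exact (hF'c.comp (by fun_prop : Continuous fun x => (t, x))).aestronglyMeasurable
    · refine .of_forall fun x u hu => ?_
      by_cases hx : x ∈ closedBall (0 : EuclideanSpace ℝ (Fin m)) r
      · rw [Set.indicator_of_mem hx]
        exact hC (u, x) ⟨hu, hx⟩
      · rw [Set.indicator_of_notMem hx, hout x hx]
        simp
    · exact (integrable_indicator_iff measurableSet_closedBall).2
        (integrableOn_const measure_closedBall_lt_top.ne)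
    · refine .of_forall fun x u _ => HasDerivAt.const_mul _ ?_
      have h1 : HasDerivAt (fun t : ℝ => ξ + t • x) x u := by
        simpa using ((hasDerivAt_id u).smul_const x).const_add ξ
      exact ((hw.differentiable two_ne_zero) (ξ + u • x)).hasFDerivAt.comp_hasDerivAt u h1
  have hmon : MonotoneOn (fun t : ℝ => ∫ x, deriv G (‖x‖ ^ 2) * w (ξ + t • x)) (Set.Icc 0 1) := by
    refine monotoneOn_of_deriv_nonneg (convex_Icc 0 1)
      (fun t _ => (hder t).continuousAt.continuousWithinAt)
      (fun t _ => (hder t).differentiableAt.differentiableWithinAt) fun t ht => ?_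
    rw [interior_Icc] at ht
    rw [(hder t).deriv]
    have h2 := integral_radial_mul_fderiv_eq hw hG hGb ξ t
    have h3 : ∫ x, G (‖x‖ ^ 2) * ∑ i, fderiv ℝ (fun y => fderiv ℝ w y (EuclideanSpace.single i 1))
          (ξ + t • x) (EuclideanSpace.single i 1) ≤ 0 := by
      refine integral_nonpos fun x => ?_
      by_cases hx : ‖x‖ < r
      · refine mul_nonpos_of_nonpos_of_nonneg (hG0 _) (hlap _ ?_)
        rw [mem_ball, dist_eq_norm, add_sub_cancel_left, norm_smul, Real.norm_eq_abs,
          abs_of_pos ht.1]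
        nlinarith [norm_nonneg x, ht.2, ht.1]
      · have : G (‖x‖ ^ 2) = 0 := hGb _ (by gcongr; exact not_lt.1 hx)
        simp [this]
    nlinarith [ht.1]
  have := hmon (Set.left_mem_Icc.2 zero_le_one) (Set.right_mem_Icc.2 zero_le_one) zero_le_one
  simp only [zero_smul, add_zero, one_smul, integral_mul_const] at this
  rwa [mul_comm] at this

/-- Sub-mean-value inequality on spheres for functions that are `C²` on the whole space and
have nonnegative Laplacian in the ball. -/
theorem le_average_sphere_of_laplacian_nonneg {m : ℕ} [NeZero m] {w : EuclideanSpace ℝ (Fin m) → ℝ}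
    (hw : ContDiff ℝ 2 w) {ξ : EuclideanSpace ℝ (Fin m)} {r : ℝ} (hr : 0 < r)
    (hlap : ∀ z ∈ ball ξ r, 0 ≤ ∑ i, fderiv ℝ (fun y => fderiv ℝ w y (EuclideanSpace.single i 1))
          z (EuclideanSpace.single i 1)) :
    w ξ ≤ ⨍ s : sphere (0 : EuclideanSpace ℝ (Fin m)) 1,
      w (ξ + r • (s : EuclideanSpace ℝ (Fin m)))
        ∂((volume : Measure (EuclideanSpace ℝ (Fin m))).toSphere) := by
  set σ := (volume : Measure (EuclideanSpace ℝ (Fin m))).toSphere with hσ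
  have hσ0 : NeZero σ := ⟨Measure.toSphere_ne_zero _⟩
  have hwc := hw.continuous
  let A : ℝ → ℝ := fun ρ => ⨍ s : sphere (0 : EuclideanSpace ℝ (Fin m)) 1,
    w (ξ + ρ • (s : EuclideanSpace ℝ (Fin m))) ∂σ
  have hA : Continuous A := by
    have hc : Continuous (Function.uncurry fun (ρ : ℝ)
        (s : sphere (0 : EuclideanSpace ℝ (Fin m)) 1) =>
          w (ξ + ρ • (s : EuclideanSpace ℝ (Fin m)))) := by
      unfold Function.uncurry
      fun_prop
    have hi : Continuous fun ρ : ℝ => ∫ s : sphere (0 : EuclideanSpace ℝ (Fin m)) 1,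
        w (ξ + ρ • (s : EuclideanSpace ℝ (Fin m))) ∂σ := by
      simpa using continuous_parametric_integral_of_continuous (μ := σ) hc isCompact_univ
    simp only [A, average_eq, smul_eq_mul]
    exact continuous_const.mul hi
  change w ξ ≤ A r
  by_contra! hlt
  obtain ⟨c, hc1, hc2⟩ := exists_between hlt
  obtain ⟨a, ⟨ha0, har⟩, ha⟩ : ∃ a ∈ Set.Ioo 0 r, ∀ ρ ∈ Set.Ioc a r, A ρ < c := by
    have h1 : ∀ᶠ ρ in nhds r, A ρ < c := hA.continuousAt.eventually_lt_const hc1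
    obtain ⟨δ, hδ, h2⟩ := Metric.eventually_nhds_iff.1 h1
    refine ⟨max (r / 2) (r - δ), ⟨by positivity, by simp [hr, hδ]⟩, fun ρ hρ => h2 ?_⟩
    have := (le_max_right (r / 2) (r - δ)).trans_lt hρ.1
    rw [Real.dist_eq, abs_lt]
    exact ⟨by linarith, by linarith [hρ.2]⟩
  have hab : a ^ 2 < r ^ 2 := by gcongr
  let G : ℝ → ℝ := fun s => Real.smoothTransition ((s - a ^ 2) / (r ^ 2 - a ^ 2)) - 1
  have hd : 0 < r ^ 2 - a ^ 2 := sub_pos.2 hab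
  have hG : ContDiff ℝ 1 G :=
    (Real.smoothTransition.contDiff (n := 1)).comp
      (f := fun s : ℝ => (s - a ^ 2) / (r ^ 2 - a ^ 2)) (by fun_prop) |>.sub contDiff_const
  have hmono : Monotone G := fun x y hxy =>
    sub_le_sub_right (Real.smoothTransition.monotone (by gcongr)) 1
  have hGb : ∀ s, r ^ 2 ≤ s → G s = 0 := fun s hs => by
    simp only [G]
    rw [Real.smoothTransition.one_of_one_le, sub_self]
    rw [le_div_iff₀ hd]
    linarith
  have hGa : ∀ s, s ≤ a ^ 2 → G s = -1 := fun s hs => by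
    simp only [G]
    rw [Real.smoothTransition.zero_of_nonpos, zero_sub]
    exact div_nonpos_of_nonpos_of_nonneg (by linarith) hd.le
  have hdnn : ∀ s, 0 ≤ deriv G s := fun s => hmono.deriv_nonneg
  have hdb : ∀ s, r ^ 2 < s → deriv G s = 0 := fun s hs => by
    have : G =ᶠ[nhds s] fun _ => 0 := by
      filter_upwards [lt_mem_nhds hs] with u hu using hGb u hu.le
    rw [this.deriv_eq, deriv_const]
  have hda : ∀ s, s ≤ a ^ 2 → deriv G s = 0 := by
    have h1 : ∀ s < a ^ 2, deriv G s = 0 := fun s hs => by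
      have : G =ᶠ[nhds s] fun _ => -1 := by
        filter_upwards [gt_mem_nhds hs] with u hu using hGa u (le_of_lt hu)
      rw [this.deriv_eq, deriv_const]
    have hcl : IsClosed {s | deriv G s = 0} :=
      isClosed_eq (hG.continuous_deriv le_rfl) continuous_const
    intro s hs
    have h2 : closure (Set.Iio (a ^ 2)) ⊆ {s | deriv G s = 0} := closure_minimal h1 hcl
    rw [closure_Iio] at h2
    exact h2 hs
  have hhx : Continuous fun x : EuclideanSpace ℝ (Fin m) => deriv G (‖x‖ ^ 2) :=
    (hG.continuous_deriv le_rfl).comp (by fun_prop)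
  have hhs : HasCompactSupport fun x : EuclideanSpace ℝ (Fin m) => deriv G (‖x‖ ^ 2) := by
    refine HasCompactSupport.intro (isCompact_closedBall 0 r) fun x hx => ?_
    rw [mem_closedBall_zero_iff, not_le] at hx
    exact hdb _ (by gcongr)
  have hpos : 0 < ∫ x : EuclideanSpace ℝ (Fin m), deriv G (‖x‖ ^ 2) := by
    obtain ⟨s, ⟨hs, -⟩, hs'⟩ := exists_deriv_eq_slope G hab hG.continuous.continuousOn
      (hG.differentiable one_ne_zero).differentiableOn
    have hs0 : 0 ≤ s := (sq_nonneg a).trans hs.le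
    refine hhx.integral_pos_of_hasCompactSupport_nonneg_nonzero
      (x := EuclideanSpace.single 0 (Real.sqrt s)) hhs (fun x => hdnn _) ?_
    rw [PiLp.norm_single, Real.norm_eq_abs, sq_abs, Real.sq_sqrt hs0, hs',
      hGb _ le_rfl, hGa _ le_rfl]
    have : (0 - -1) / (r ^ 2 - a ^ 2) > 0 := by positivity
    exact this.ne'
  have hle := mul_integral_radial_le hw hr hlap hG hmono hGb
  have hpolar : ∫ x, deriv G (‖x‖ ^ 2) * (w (ξ + x) - c) ≤ 0 := by
    refine integral_nonpos_of_sphere_integral_nonpos volume _ fun ρ hρ => ?_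
    have hn : ∀ s : sphere (0 : EuclideanSpace ℝ (Fin m)) 1,
        ‖ρ • (s : EuclideanSpace ℝ (Fin m))‖ ^ 2 = ρ ^ 2 := fun s => by
      rw [norm_smul, norm_eq_of_mem_sphere, mul_one, Real.norm_eq_abs, sq_abs]
    simp only [hn]
    rw [integral_const_mul]
    by_cases h0 : ρ ∈ Set.Ioc a r
    · refine mul_nonpos_of_nonneg_of_nonpos (hdnn _) ?_
      rw [← hσ]
      have hi : Integrable (fun s : sphere (0 : EuclideanSpace ℝ (Fin m)) 1 =>
          w (ξ + ρ • (s : EuclideanSpace ℝ (Fin m)))) σ :=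
        Continuous.integrable_of_hasCompactSupport (by fun_prop)
          (HasCompactSupport.of_compactSpace _)
      rw [integral_sub hi (integrable_const _), integral_const, ← measure_smul_average,
        ← smul_sub]
      exact mul_nonpos_of_nonneg_of_nonpos measureReal_nonneg (sub_nonpos.2 (ha ρ h0).le)
    · rw [Set.mem_Ioc, not_and_or, not_lt, not_le] at h0
      rcases h0 with h0 | h0
      · rw [hda _ (by gcongr), zero_mul]
      · rw [hdb _ (by gcongr), zero_mul]
  have hsplit : ∫ x, deriv G (‖x‖ ^ 2) * (w (ξ + x) - c)
      = (∫ x, deriv G (‖x‖ ^ 2) * w (ξ + x))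
        - (∫ x : EuclideanSpace ℝ (Fin m), deriv G (‖x‖ ^ 2)) * c := by
    simp only [mul_sub]
    rw [integral_sub, integral_mul_const]
    · exact Continuous.integrable_of_hasCompactSupport (by fun_prop) hhs.mul_right
    · exact (hhx.integrable_of_hasCompactSupport hhs).mul_const c
  nlinarith

/-- Functions that are `C²` on an open set with nonnegative Laplacian are subharmonic there. -/
theorem subMeanSphere_of_laplacian_nonneg {m : ℕ} [NeZero m] {v : EuclideanSpace ℝ (Fin m) → ℝ}
    {U : Set (EuclideanSpace ℝ (Fin m))} (hU : IsOpen U) (hv : ContDiffOn ℝ 2 v U)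
    (hlap : ∀ z ∈ U, 0 ≤ ∑ i, fderiv ℝ (fun y => fderiv ℝ v y (EuclideanSpace.single i 1))
          z (EuclideanSpace.single i 1)) :
    SubMeanSphere v U := by
  intro ξ hξ r hr hball
  obtain ⟨δ, hδ, hδU⟩ := (isCompact_closedBall ξ r).exists_cthickening_subset_open hU hball
  rw [cthickening_closedBall hδ.le hr.le] at hδU
  let χ : ContDiffBump ξ := ⟨r, δ + r, hr, by linarith⟩
  let w : EuclideanSpace ℝ (Fin m) → ℝ := fun z => χ z * v z
  have hw : ContDiff ℝ 2 w := by
    rw [contDiff_iff_contDiffAt]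
    intro z
    by_cases hz : z ∈ U
    · exact χ.contDiffAt.mul (hv.contDiffAt (hU.mem_nhds hz))
    · have hz' : z ∉ tsupport χ := fun h => hz (hδU (by simpa [χ.tsupport_eq, χ] using h))
      have : w =ᶠ[nhds z] fun _ => 0 := by
        filter_upwards [(isClosed_tsupport χ).isOpen_compl.mem_nhds hz'] with y hy
        simp [w, image_eq_zero_of_notMem_tsupport hy]
      exact contDiffAt_const.congr_of_eventuallyEq this
  have hwv : ∀ z ∈ closedBall ξ r, w z = v z := fun z hz => by
    simp [w, χ.one_of_mem_closedBall hz]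
  have hev : ∀ z ∈ ball ξ r, w =ᶠ[nhds z] v := fun z hz => by
    filter_upwards [isOpen_ball.mem_nhds hz] with y hy using hwv y (ball_subset_closedBall hy)
  have h1 := le_average_sphere_of_laplacian_nonneg hw hr (ξ := ξ) (fun z hz => by
    refine (hlap z (hball (ball_subset_closedBall hz))).trans_eq
      (Finset.sum_congr rfl fun i _ => ?_)
    have : (fun y => fderiv ℝ w y (EuclideanSpace.single i 1))
        =ᶠ[nhds z] fun y => fderiv ℝ v y (EuclideanSpace.single i 1) := by
      filter_upwards [isOpen_ball.mem_nhds hz] with y hy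
      rw [(hev y hy).fderiv_eq]
    rw [this.fderiv_eq])
  rw [hwv ξ (mem_closedBall_self hr.le)] at h1
  refine h1.trans_eq ?_
  congr 1
  funext s
  refine hwv _ ?_
  rw [mem_closedBall, dist_eq_norm, add_sub_cancel_left, norm_smul, norm_eq_of_mem_sphere, mul_one,
    Real.norm_eq_abs, abs_of_pos hr]

/-- For a traceless symmetric matrix `A`, the operator norm is controlled by the Frobenius norm
with the constant `n / (n + 1)`. -/
theorem sum_sq_mulVec_le_of_traceless {n : ℕ} (A : Fin (n + 1) → Fin (n + 1) → ℝ)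
    (hA : ∀ j k, A j k = A k j) (htr : ∑ j, A j j = 0) (x : Fin (n + 1) → ℝ) :
    (n + 1) * ∑ j, (∑ k, A j k * x k) ^ 2 ≤ n * ((∑ j, x j ^ 2) * ∑ j, ∑ k, A j k ^ 2) := by
  rcases Nat.eq_zero_or_pos n with rfl | hn
  · have : A 0 0 = 0 := by simpa using htr
    simp [this]
  set y : Fin (n + 1) → ℝ := fun j => ∑ k, A j k * x k with hy
  set X := ∑ j, x j ^ 2 with hX
  set Y := ∑ j, y j ^ 2 with hY
  set M := ∑ j, ∑ k, A j k ^ 2 with hM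
  set c := ∑ j, x j * y j with hc
  have hn1 : (1 : ℝ) ≤ n := by exact_mod_cast hn
  let d : ℝ := c / (n + 1)
  have hd : (n + 1) * d = c := by simp only [d]; field_simp
  let B : Fin (n + 1) → Fin (n + 1) → ℝ := fun j k =>
    y j * x k + x j * y k - if j = k then 2 * d else 0
  have hAB : ∑ j, ∑ k, A j k * B j k = 2 * Y := by
    have h1 : ∑ j, ∑ k, A j k * (y j * x k) = Y := by
      refine Finset.sum_congr rfl fun j _ => ?_
      rw [sq, hy, Finset.mul_sum]
      exact Finset.sum_congr rfl fun k _ => by ring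
    have h2 : ∑ j, ∑ k, A j k * (x j * y k) = Y := by
      rw [Finset.sum_comm, ← h1]
      refine Finset.sum_congr rfl fun j _ => Finset.sum_congr rfl fun k _ => ?_
      rw [hA k j]
      ring
    have h3 : ∑ j, ∑ k, A j k * (if j = k then 2 * d else 0) = 0 := by
      simp [← Finset.sum_mul, htr]
    simp only [B, mul_sub, mul_add, Finset.sum_sub_distrib, Finset.sum_add_distrib, h1, h2, h3]
    ring
  have hBB : ∑ j, ∑ k, B j k ^ 2 = 2 * (X * Y) + 2 * c ^ 2 - 4 * d * c := by
    have e1 : ∀ j k, B j k ^ 2 = y j ^ 2 * x k ^ 2 + x j ^ 2 * y k ^ 2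
        + 2 * ((x j * y j) * (x k * y k))
        - (if j = k then 8 * d * (x j * y j) - 4 * d ^ 2 else 0) := by
      intro j k
      simp only [B]
      split_ifs with h
      · subst h; ring
      · ring
    simp only [e1, Finset.sum_sub_distrib, Finset.sum_add_distrib, ← Finset.mul_sum,
      ← Finset.sum_mul, Finset.sum_ite_eq, Finset.mem_univ, if_true, Finset.sum_const,
      Finset.card_univ, Fintype.card_fin, nsmul_eq_mul]
    rw [← hX, ← hY, ← hc]
    push_cast
    linear_combination (4 * d) * hd
  have hCS : (2 * Y) ^ 2 ≤ M * (2 * (X * Y) + 2 * c ^ 2 - 4 * d * c) := by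
    have := Finset.sum_mul_sq_le_sq_mul_sq (Finset.univ : Finset (Fin (n + 1) × Fin (n + 1)))
      (fun p => A p.1 p.2) (fun p => B p.1 p.2)
    simp only [Fintype.sum_prod_type] at this
    rwa [hAB, hBB] at this
  have hcs : c ^ 2 ≤ X * Y := Finset.sum_mul_sq_le_sq_mul_sq _ _ _
  have hM0 : 0 ≤ M := Finset.sum_nonneg fun _ _ => Finset.sum_nonneg fun _ _ => sq_nonneg _
  have hX0 : 0 ≤ X := Finset.sum_nonneg fun _ _ => sq_nonneg _
  have hY0 : 0 ≤ Y := Finset.sum_nonneg fun _ _ => sq_nonneg _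
  have hB : (n + 1) * (2 * (X * Y) + 2 * c ^ 2 - 4 * d * c) ≤ 4 * n * (X * Y) := by
    have : (n + 1) * (2 * (X * Y) + 2 * c ^ 2 - 4 * d * c)
        = 2 * (n + 1) * (X * Y) + 2 * (n - 1) * c ^ 2 := by
      linear_combination (-4 * c) * hd
    rw [this]
    nlinarith [mul_le_mul_of_nonneg_left hcs (sub_nonneg.2 hn1)]
  have hfin : Y * ((n + 1) * Y) ≤ Y * (n * (X * M)) := by
    have h1 := mul_le_mul_of_nonneg_left hCS (by positivity : (0 : ℝ) ≤ n + 1)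
    have h2 := mul_le_mul_of_nonneg_left hB hM0
    nlinarith
  rcases hY0.eq_or_lt with h0 | h0
  · rw [← h0, mul_zero]
    positivity
  · exact le_of_mul_le_mul_left hfin h0

/-- The Laplacian of `(|F|² + ε) ^ p` for a vector `F` of harmonic functions. -/
theorem sum_fderiv_fderiv_rpow {m k : ℕ} {U : Set (EuclideanSpace ℝ (Fin m))} (hU : IsOpen U)
    {F : Fin k → EuclideanSpace ℝ (Fin m) → ℝ} (hF : ∀ j, ContDiffOn ℝ 2 (F j) U)
    (hharm : ∀ j, ∀ z ∈ U, ∑ i, fderiv ℝ (fun w => fderiv ℝ (F j) w (EuclideanSpace.single i 1)) z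
          (EuclideanSpace.single i 1) = 0)
    {ε : ℝ} (hε : 0 < ε) (p : ℝ) {z : EuclideanSpace ℝ (Fin m)} (hz : z ∈ U) :
    ∑ i, fderiv ℝ (fun y => fderiv ℝ (fun x => (∑ j, F j x ^ 2 + ε) ^ p) y
        (EuclideanSpace.single i 1)) z (EuclideanSpace.single i 1)
      = 2 * p * (∑ j, F j z ^ 2 + ε) ^ (p - 2) *
        ((∑ j, F j z ^ 2 + ε) * (∑ i, ∑ j, fderiv ℝ (F j) z (EuclideanSpace.single i 1) ^ 2)
          + 2 * (p - 1) *
            ∑ i, (∑ j, fderiv ℝ (F j) z (EuclideanSpace.single i 1) * F j z) ^ 2) := by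
  let e : Fin m → EuclideanSpace ℝ (Fin m) := fun i => EuclideanSpace.single i 1
  let S : EuclideanSpace ℝ (Fin m) → ℝ := fun x => ∑ j, F j x ^ 2 + ε
  have hS : ∀ x, 0 < S x := fun x => add_pos_of_nonneg_of_pos
    (Finset.sum_nonneg fun _ _ => sq_nonneg _) hε
  have hF1 : ∀ j, ∀ x ∈ U, HasFDerivAt (F j) (fderiv ℝ (F j) x) x := fun j x hx =>
    (((hF j).contDiffAt (hU.mem_nhds hx)).differentiableAt two_ne_zero).hasFDerivAt
  have hF2 : ∀ j i, ∀ x ∈ U, HasFDerivAt (fun y => fderiv ℝ (F j) y (e i))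
      (fderiv ℝ (fun y => fderiv ℝ (F j) y (e i)) x) x := fun j i x hx => by
    have h1 : ContDiffAt ℝ 1 (fderiv ℝ (F j)) x :=
      ((hF j).contDiffAt (hU.mem_nhds hx)).fderiv_right (by norm_num)
    exact ((h1.differentiableAt one_ne_zero).clm_apply (differentiableAt_const _)).hasFDerivAt
  have hS1 : ∀ x ∈ U, HasFDerivAt S (∑ j, (2 * F j x) • fderiv ℝ (F j) x) x := fun x hx => by
    refine HasFDerivAt.add_const ε (HasFDerivAt.fun_sum fun j _ => ?_)
    simpa using (hF1 j x hx).pow 2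
  have hpow : ∀ r : ℝ, ∀ x ∈ U, HasFDerivAt (fun x => S x ^ r)
      ((r * S x ^ (r - 1)) • ∑ j, (2 * F j x) • fderiv ℝ (F j) x) x := fun r x hx =>
    (hS1 x hx).rpow_const (Or.inl (hS x).ne')
  have hfirst : ∀ i, ∀ x ∈ U, fderiv ℝ (fun x => S x ^ p) x (e i)
      = 2 * p * (S x ^ (p - 1) * ∑ j, fderiv ℝ (F j) x (e i) * F j x) := fun i x hx => by
    rw [(hpow p x hx).fderiv]
    simp only [smul_apply, sum_apply, smul_eq_mul,
      Finset.mul_sum]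
    exact Finset.sum_congr rfl fun j _ => by ring
  have hsecond : ∀ i, fderiv ℝ (fun y => fderiv ℝ (fun x => S x ^ p) y (e i)) z (e i)
      = 2 * p * S z ^ (p - 2) * (S z * (∑ j, fderiv ℝ (F j) z (e i) ^ 2
          + ∑ j, F j z * fderiv ℝ (fun w => fderiv ℝ (F j) w (e i)) z (e i))
        + 2 * (p - 1) * (∑ j, fderiv ℝ (F j) z (e i) * F j z) ^ 2) := fun i => by
    have hev : (fun y => fderiv ℝ (fun x => S x ^ p) y (e i)) =ᶠ[nhds z]
        fun x => 2 * p * (S x ^ (p - 1) * ∑ j, fderiv ℝ (F j) x (e i) * F j x) := by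
      filter_upwards [hU.mem_nhds hz] with x hx using hfirst i x hx
    have hd := ((hpow (p - 1) z hz).mul
      (HasFDerivAt.fun_sum (u := Finset.univ) fun j _ => (hF2 j i z hz).mul (hF1 j z hz))).const_mul
      (2 * p)
    have hd' := hd.fderiv
    rw [hev.fderiv_eq]
    refine (congrArg (fun L => L (e i)) hd').trans ?_
    have hp1 : S z ^ (p - 1) = S z ^ (p - 2) * S z := by
      rw [← Real.rpow_add_one (hS z).ne']
      congr 1
      ring
    have hp2 : p - 1 - 1 = p - 2 := by ring
    have hs : ∑ j, 2 * F j z * fderiv ℝ (F j) z (e i)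
        = 2 * ∑ j, fderiv ℝ (F j) z (e i) * F j z := by
      rw [Finset.mul_sum]
      exact Finset.sum_congr rfl fun j _ => by ring
    simp only [smul_apply, sum_apply, smul_eq_mul,
      add_apply, Pi.mul_apply, Finset.sum_add_distrib, hs, hp1, hp2, ← sq]
    ring
  have hzero : ∑ i, ∑ j, F j z * fderiv ℝ (fun w => fderiv ℝ (F j) w (e i)) z (e i) = 0 := by
    rw [Finset.sum_comm]
    refine Finset.sum_eq_zero fun j _ => ?_
    rw [← Finset.mul_sum, hharm j z hz, mul_zero]
  refine (Finset.sum_congr rfl fun i _ => hsecond i).trans ?_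
  rw [← Finset.mul_sum, Finset.sum_add_distrib, ← Finset.mul_sum, ← Finset.mul_sum,
    Finset.sum_add_distrib, hzero, add_zero]

/-- If the regularizations `(S + ε) ^ p` of a power of a nonnegative continuous function are all
subharmonic, then so is `S ^ p`. -/
theorem subMeanSphere_rpow_of_add_const {m : ℕ} {U : Set (EuclideanSpace ℝ (Fin m))}
    {S : EuclideanSpace ℝ (Fin m) → ℝ} (hS : ContinuousOn S U) (hS0 : ∀ z, 0 ≤ S z)
    {p : ℝ} (hp : 0 ≤ p) (h : ∀ ε > 0, SubMeanSphere (fun z => (S z + ε) ^ p) U) :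
    SubMeanSphere (fun z => S z ^ p) U := by
  intro ξ hξ r hr hball
  set σ := (volume : Measure (EuclideanSpace ℝ (Fin m))).toSphere
  have hmem : ∀ s : sphere (0 : EuclideanSpace ℝ (Fin m)) 1,
      ξ + r • (s : EuclideanSpace ℝ (Fin m)) ∈ U := fun s => hball <| by
    rw [mem_closedBall, dist_eq_norm, add_sub_cancel_left, norm_smul, norm_eq_of_mem_sphere,
      mul_one, Real.norm_eq_abs, abs_of_pos hr]
  have hc : Continuous fun s : sphere (0 : EuclideanSpace ℝ (Fin m)) 1 =>
      S (ξ + r • (s : EuclideanSpace ℝ (Fin m))) := hS.comp_continuous (by fun_prop) hmem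
  have hcp : ∀ ε : ℝ, Continuous fun s : sphere (0 : EuclideanSpace ℝ (Fin m)) 1 =>
      (S (ξ + r • (s : EuclideanSpace ℝ (Fin m))) + ε) ^ p := fun ε =>
    (hc.add continuous_const).rpow_const fun _ => Or.inr hp
  have hlim : Tendsto (fun ε : ℝ => ⨍ s : sphere (0 : EuclideanSpace ℝ (Fin m)) 1,
      (S (ξ + r • (s : EuclideanSpace ℝ (Fin m))) + ε) ^ p ∂σ) (nhdsWithin 0 (Set.Ioi 0))
      (nhds (⨍ s : sphere (0 : EuclideanSpace ℝ (Fin m)) 1,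
        S (ξ + r • (s : EuclideanSpace ℝ (Fin m))) ^ p ∂σ)) := by
    simp only [average_eq]
    refine Tendsto.const_smul ?_ _
    refine tendsto_integral_filter_of_dominated_convergence
      (fun s => (S (ξ + r • (s : EuclideanSpace ℝ (Fin m))) + 1) ^ p) ?_ ?_ ?_ ?_
    · exact .of_forall fun ε => (hcp ε).aestronglyMeasurable
    · filter_upwards [Ioo_mem_nhdsGT one_pos] with ε hε
      refine .of_forall fun s => ?_
      have h0 := hS0 (ξ + r • (s : EuclideanSpace ℝ (Fin m)))
      have h1 : 0 ≤ S (ξ + r • (s : EuclideanSpace ℝ (Fin m))) + ε := add_nonneg h0 hε.1.le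
      rw [Real.norm_eq_abs, abs_of_nonneg (Real.rpow_nonneg h1 p)]
      exact Real.rpow_le_rpow h1 (by linarith [hε.2]) hp
    · exact (hcp 1).integrable_of_hasCompactSupport (HasCompactSupport.of_compactSpace _)
    · refine .of_forall fun s => ?_
      have : Continuous fun ε : ℝ => (S (ξ + r • (s : EuclideanSpace ℝ (Fin m))) + ε) ^ p :=
        (continuous_const.add continuous_id).rpow_const fun _ => Or.inr hp
      simpa using (this.tendsto 0).mono_left nhdsWithin_le_nhds
  refine ge_of_tendsto hlim ?_
  filter_upwards [self_mem_nhdsWithin] with ε hε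
  have hε' : 0 < ε := hε
  exact (Real.rpow_le_rpow (hS0 ξ) (by linarith) hp).trans (h ε hε ξ hξ r hr hball)

/-- **Subharmonicity of powers of Cauchy–Riemann systems.** Let
`F = (u_0, …, u_n)` be a vector of harmonic functions on the upper half-space
`ℝ^{n+1}_+ = {z : 0 < z 0}` (coordinate `0` playing the role of `t = x_0`) satisfying
the generalized Cauchy–Riemann equations `∑_j ∂u_j/∂x_j = 0` and
`∂u_j/∂x_k = ∂u_k/∂x_j`. Then for every `q ≥ (n-1)/n`, the function
`|F|^q = (∑_j u_j²)^{q/2}` is subharmonic on `ℝ^{n+1}_+`. -/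
theorem stmt_10 (n : ℕ) (F : Fin (n + 1) → EuclideanSpace ℝ (Fin (n + 1)) → ℝ)
    (hsmooth : ∀ j, ContDiffOn ℝ 2 (F j) {z : EuclideanSpace ℝ (Fin (n + 1)) | 0 < z 0})
    (hharm : ∀ j, ∀ z ∈ {z : EuclideanSpace ℝ (Fin (n + 1)) | 0 < z 0},
      ∑ i : Fin (n + 1),
        fderiv ℝ (fun w => fderiv ℝ (F j) w (EuclideanSpace.single i 1)) z
          (EuclideanSpace.single i 1) = 0)
    (hdiv : ∀ z ∈ {z : EuclideanSpace ℝ (Fin (n + 1)) | 0 < z 0},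
      ∑ j : Fin (n + 1), fderiv ℝ (F j) z (EuclideanSpace.single j 1) = 0)
    (hsym : ∀ j k : Fin (n + 1), ∀ z ∈ {z : EuclideanSpace ℝ (Fin (n + 1)) | 0 < z 0},
      fderiv ℝ (F j) z (EuclideanSpace.single k 1)
        = fderiv ℝ (F k) z (EuclideanSpace.single j 1))
    (q : ℝ) (hq : ((n : ℝ) - 1) / n ≤ q) :
    SubMeanSphere (fun z => (∑ j : Fin (n + 1), (F j z) ^ 2) ^ (q / 2))
      {z : EuclideanSpace ℝ (Fin (n + 1)) | 0 < z 0} := by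
  have hU : IsOpen {z : EuclideanSpace ℝ (Fin (n + 1)) | 0 < z 0} :=
    isOpen_lt continuous_const (by fun_prop)
  have hn : (n : ℝ) - 1 ≤ n * q := by
    rcases Nat.eq_zero_or_pos n with rfl | hn
    · simp
    · rw [div_le_iff₀ (by exact_mod_cast hn)] at hq
      linarith
  have hq0 : 0 ≤ q := by
    refine le_trans ?_ hq
    rcases Nat.eq_zero_or_pos n with rfl | hn
    · simp
    · have : (1 : ℝ) ≤ n := by exact_mod_cast hn
      exact div_nonneg (by linarith) (by linarith)
  refine subMeanSphere_rpow_of_add_const (S := fun z => ∑ j, F j z ^ 2)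
    (continuousOn_finsetSum _ fun j _ => (hsmooth j).continuousOn.pow 2)
    (fun z => Finset.sum_nonneg fun j _ => sq_nonneg _) (by positivity) fun ε hε => ?_
  have hS : ∀ z, 0 < ∑ j, F j z ^ 2 + ε := fun z => add_pos_of_nonneg_of_pos
    (Finset.sum_nonneg fun _ _ => sq_nonneg _) hε
  refine subMeanSphere_of_laplacian_nonneg hU ?_ fun z hz => ?_
  · exact ((ContDiffOn.sum fun j _ => (hsmooth j).pow 2).add contDiffOn_const).rpow_const_of_ne
      fun z _ => (hS z).ne'
  rw [sum_fderiv_fderiv_rpow hU hsmooth hharm hε (q / 2) hz]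
  refine mul_nonneg (mul_nonneg (by positivity) (Real.rpow_nonneg (hS z).le _)) ?_
  have key := sum_sq_mulVec_le_of_traceless
    (fun i j => fderiv ℝ (F j) z (EuclideanSpace.single i 1))
    (fun i j => hsym j i z hz) (hdiv z hz) (fun j => F j z)
  set Y := ∑ i, (∑ j, fderiv ℝ (F j) z (EuclideanSpace.single i 1) * F j z) ^ 2
  set M := ∑ i, ∑ j, fderiv ℝ (F j) z (EuclideanSpace.single i 1) ^ 2
  set s := ∑ j, F j z ^ 2
  have hY : 0 ≤ Y := Finset.sum_nonneg fun _ _ => sq_nonneg _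
  have hM : 0 ≤ M := Finset.sum_nonneg fun _ _ => Finset.sum_nonneg fun _ _ => sq_nonneg _
  have hεM : 0 ≤ ε * M := mul_nonneg hε.le hM
  suffices 0 ≤ s * M + (q - 2) * Y by linarith
  rcases Nat.eq_zero_or_pos n with rfl | hn'
  · have hY0 : Y = 0 := le_antisymm (by simpa using key) hY
    rw [hY0, mul_zero, add_zero]
    exact mul_nonneg (Finset.sum_nonneg fun _ _ => sq_nonneg _) hM
  · refine nonneg_of_mul_nonneg_right (a := (n : ℝ)) ?_ (by exact_mod_cast hn')
    nlinarith [mul_le_mul_of_nonneg_right hn hY]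
end
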